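/- arXiv:0907.4780 — 8 statements merged into one kernel-verified Lean document; each statement's English description precedes it below -/
import Mathlib

section
/- Let L be a Lie algebra over a field K of characteristic different from 2 and 3, and let d: L → L* be an antiderivation of L to its coadjoint module. Then the bilinear form v(d): L × L → K defined by v(d)(x,y) = d(x)(y) − d(y)(x) is skew-symmetric and cyclic, i.e. v(d)([x,y],z) = v(d)([z,x],y) for all x,y,z ∈ L. -/
/-- For a Lie algebra `L` over a field `K` of characteristic `≠ 2, 3` and an
antiderivation `d : L → L*` of `L` to its coadjoint module, the bilinear form
`v(d)(x,y) = d(x)(y) − d(y)(x)` is skew-symmetric and cyclic. -/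
theorem antiderivation_gives_cyclic_form
    (K : Type*) [Field K] (h2 : (2 : K) ≠ 0) (h3 : (3 : K) ≠ 0)
    (L : Type*) [LieRing L] [LieAlgebra K L]
    (d : L →ₗ[K] Module.Dual K L)
    (hd : ∀ x y z : L, d ⁅x, y⁆ z = d y ⁅x, z⁆ - d x ⁅y, z⁆) :
    (∀ x y : L, d x y - d y x = -(d y x - d x y)) ∧
    (∀ x y z : L,
      d ⁅x, y⁆ z - d z ⁅x, y⁆ = d ⁅z, x⁆ y - d y ⁅z, x⁆) := by
  refine ⟨fun x y => by ring, fun x y z => ?_⟩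
  rw [hd x y z, hd z x y, ← lie_skew x z, ← lie_skew z y, map_neg, map_neg]
  ring
end

section
/- Let L be a finite-dimensional simple Lie algebra over a field K of characteristic different from 2 and 3. Then every skew-symmetric cyclic bilinear form on L is zero, i.e. C(L) = 0. -/
/-- On a finite-dimensional simple Lie algebra over a field of
characteristic `≠ 2, 3`, every skew-symmetric cyclic bilinear form vanishes, i.e. `C(L) = 0`. -/
theorem cyclic_forms_vanish_on_simple
    (K : Type*) [Field K] (h2 : (2 : K) ≠ 0) (h3 : (3 : K) ≠ 0)
    (L : Type*) [LieRing L] [LieAlgebra K L]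
    [FiniteDimensional K L] [LieAlgebra.IsSimple K L]
    (ψ : L →ₗ[K] L →ₗ[K] K)
    (hskew : ∀ x y : L, ψ x y = -ψ y x)
    (hcyclic : ∀ x y z : L, ψ ⁅x, y⁆ z = ψ ⁅z, x⁆ y) :
    ψ = 0 := by
  have hadj : ∀ y x z : L, ψ ⁅y, x⁆ z = ψ x ⁅y, z⁆ := by
    intro y x z
    rw [hskew x ⁅y, z⁆, hcyclic y z x, ← lie_skew y x, map_neg, LinearMap.neg_apply]
  have key : ∀ y w x z : L, ψ ⁅⁅y, w⁆, x⁆ z = 0 := by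
    intro y w x z
    have a := hadj ⁅y, w⁆ x z
    have b : ψ ⁅⁅y, w⁆, x⁆ z = - ψ x ⁅⁅y, w⁆, z⁆ := by
      simp only [lie_lie, map_sub, LinearMap.sub_apply, hadj]
      ring
    have c : (2 : K) * ψ ⁅⁅y, w⁆, x⁆ z = 0 := by linear_combination a + b
    exact (mul_eq_zero.mp c).resolve_left h2
  let I : LieIdeal K L :=
    { LinearMap.ker ψ with
      lie_mem := by
        intro y x hx
        have hx' : ψ x = 0 := hx
        change ψ ⁅y, x⁆ = 0
        ext z
        simp [hadj, hx'] }
  have hI : ∀ x : L, x ∈ I ↔ ψ x = 0 := fun x => Iff.rfl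
  rcases LieAlgebra.IsSimple.eq_bot_or_eq_top (R := K) I with h | h
  · exfalso
    apply LieAlgebra.IsSimple.non_abelian K (L := L)
    have hz : ∀ y w x : L, ⁅⁅y, w⁆, x⁆ = 0 := by
      intro y w x
      have : ⁅⁅y, w⁆, x⁆ ∈ I := (hI _).2 (by ext z; exact key y w x z)
      rw [h] at this
      simpa using this
    refine ⟨fun y w => ?_⟩
    have hc : ⁅y, w⁆ ∈ LieAlgebra.center K L := by
      rw [LieModule.mem_maxTrivSubmodule]
      intro x
      rw [← lie_skew, hz, neg_zero]
    rw [LieAlgebra.center_eq_bot] at hc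
    simpa using hc
  · refine LinearMap.ext fun x => ?_
    exact (hI x).1 (h ▸ LieSubmodule.mem_top x)
end

section
/- Let L be a Lie algebra over a field K of characteristic different from 2 and 3 which possesses a nonzero commutative 2-cocycle. Then L has a nonzero homomorphic image satisfying the standard identity of degree 5; that is, there exists a proper ideal I of L such that the quotient Lie algebra L/I satisfies the standard identity of degree 5. -/
open Finset

namespace CocAux

def Alt {L M : Type*} [AddCommGroup M] (f : L → L → L → L → M) (a b c d : L) : M :=
  f a b c d - f a b d c - f a c b d + f a c d b + f a d b c - f a d c b - f b a c d + f b a d c + f b c a d - f b c d a - f b d a c + f b d c a + f c a b d - f c a d b - f c b a d + f c b d a + f c d a b - f c d b a - f d a b c + f d a c b + f d b a c - f d b c a - f d c a b + f d c b a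

theorem alt_lift {L M : Type*} [AddCommGroup M] {f : L → L → L → L → M}
    (h : ∀ a b c d, f a b c d = 0) (a b c d : L) : Alt f a b c d = 0 := by
  simp [Alt, h]

theorem sum_eq_alt {L M : Type*} [AddCommGroup M] (f : L → L → L → L → M) (x : Fin 4 → L) :
    ∑ σ : Equiv.Perm (Fin 4), (Equiv.Perm.sign σ : ℤ) • f (x (σ 0)) (x (σ 1)) (x (σ 2)) (x (σ 3))
      = Alt f (x 0) (x 1) (x 2) (x 3) := by
  have e0 : ∀ e : Equiv.Perm (Fin 0), e = 1 := fun e => Subsingleton.elim _ _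
  rw [← Equiv.Perm.decomposeFin.symm.sum_comp]
  simp only [Fintype.sum_prod_type, ← (Equiv.Perm.decomposeFin (n := 2)).symm.sum_comp,
    ← (Equiv.Perm.decomposeFin (n := 1)).symm.sum_comp, Fin.sum_univ_succ, univ_unique, sum_singleton]
  have k2 : ∀ (p : Fin 4) e, Equiv.Perm.decomposeFin.symm (p, e) 2 = Equiv.swap 0 p (e 1).succ :=
    fun p e => Equiv.Perm.decomposeFin_symm_apply_succ e p 1
  have k3 : ∀ (p : Fin 4) e, Equiv.Perm.decomposeFin.symm (p, e) 3 = Equiv.swap 0 p (e 2).succ :=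
    fun p e => Equiv.Perm.decomposeFin_symm_apply_succ e p 2
  have k4 : ∀ (p : Fin 3) e, Equiv.Perm.decomposeFin.symm (p, e) 2 = Equiv.swap 0 p (e 1).succ :=
    fun p e => Equiv.Perm.decomposeFin_symm_apply_succ e p 1
  simp [Alt, k2, k3, k4, Equiv.swap_apply_def, Fin.ext_iff, Fin.succ]
  abel

theorem alt_add {L M : Type*} [AddCommGroup M] (f g : L → L → L → L → M) (a b c d : L) :
    Alt (fun a b c d => f a b c d + g a b c d) a b c d = Alt f a b c d + Alt g a b c d := by
  simp only [Alt]; abel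

theorem alt_sub {L M : Type*} [AddCommGroup M] (f g : L → L → L → L → M) (a b c d : L) :
    Alt (fun a b c d => f a b c d - g a b c d) a b c d = Alt f a b c d - Alt g a b c d := by
  simp only [Alt]; abel

theorem alt_neg {L M : Type*} [AddCommGroup M] (f : L → L → L → L → M) (a b c d : L) :
    Alt (fun a b c d => - f a b c d) a b c d = - Alt f a b c d := by
  simp only [Alt]; abel

theorem pm1243 {L M : Type*} [AddCommGroup M] (f : L → L → L → L → M) (a b c d : L) :
    Alt (fun a b c d => f a b d c) a b c d = - Alt f a b c d := by
  simp only [Alt]; abel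

theorem pm1324 {L M : Type*} [AddCommGroup M] (f : L → L → L → L → M) (a b c d : L) :
    Alt (fun a b c d => f a c b d) a b c d = - Alt f a b c d := by
  simp only [Alt]; abel

theorem pm2134 {L M : Type*} [AddCommGroup M] (f : L → L → L → L → M) (a b c d : L) :
    Alt (fun a b c d => f b a c d) a b c d = - Alt f a b c d := by
  simp only [Alt]; abel

theorem pm3412 {L M : Type*} [AddCommGroup M] (f : L → L → L → L → M) (a b c d : L) :
    Alt (fun a b c d => f c d a b) a b c d =  Alt f a b c d := by
  simp only [Alt]; abel

theorem pm2341 {L M : Type*} [AddCommGroup M] (f : L → L → L → L → M) (a b c d : L) :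
    Alt (fun a b c d => f b c d a) a b c d = - Alt f a b c d := by
  simp only [Alt]; abel

theorem pm2314 {L M : Type*} [AddCommGroup M] (f : L → L → L → L → M) (a b c d : L) :
    Alt (fun a b c d => f b c a d) a b c d =  Alt f a b c d := by
  simp only [Alt]; abel

theorem pm3124 {L M : Type*} [AddCommGroup M] (f : L → L → L → L → M) (a b c d : L) :
    Alt (fun a b c d => f c a b d) a b c d =  Alt f a b c d := by
  simp only [Alt]; abel

theorem pm4312 {L M : Type*} [AddCommGroup M] (f : L → L → L → L → M) (a b c d : L) :
    Alt (fun a b c d => f d c a b) a b c d = - Alt f a b c d := by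
  simp only [Alt]; abel

theorem pm4123 {L M : Type*} [AddCommGroup M] (f : L → L → L → L → M) (a b c d : L) :
    Alt (fun a b c d => f d a b c) a b c d = - Alt f a b c d := by
  simp only [Alt]; abel

theorem pm1423 {L M : Type*} [AddCommGroup M] (f : L → L → L → L → M) (a b c d : L) :
    Alt (fun a b c d => f a d b c) a b c d =  Alt f a b c d := by
  simp only [Alt]; abel

theorem pm1342 {L M : Type*} [AddCommGroup M] (f : L → L → L → L → M) (a b c d : L) :
    Alt (fun a b c d => f a c d b) a b c d =  Alt f a b c d := by
  simp only [Alt]; abel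

theorem pm4321 {L M : Type*} [AddCommGroup M] (f : L → L → L → L → M) (a b c d : L) :
    Alt (fun a b c d => f d c b a) a b c d =  Alt f a b c d := by
  simp only [Alt]; abel

theorem pm2143 {L M : Type*} [AddCommGroup M] (f : L → L → L → L → M) (a b c d : L) :
    Alt (fun a b c d => f b a d c) a b c d =  Alt f a b c d := by
  simp only [Alt]; abel

theorem pm3421 {L M : Type*} [AddCommGroup M] (f : L → L → L → L → M) (a b c d : L) :
    Alt (fun a b c d => f c d b a) a b c d = - Alt f a b c d := by
  simp only [Alt]; abel

theorem pm1432 {L M : Type*} [AddCommGroup M] (f : L → L → L → L → M) (a b c d : L) :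
    Alt (fun a b c d => f a d c b) a b c d = - Alt f a b c d := by
  simp only [Alt]; abel

theorem pm3214 {L M : Type*} [AddCommGroup M] (f : L → L → L → L → M) (a b c d : L) :
    Alt (fun a b c d => f c b a d) a b c d = - Alt f a b c d := by
  simp only [Alt]; abel

theorem pm2413 {L M : Type*} [AddCommGroup M] (f : L → L → L → L → M) (a b c d : L) :
    Alt (fun a b c d => f b d a c) a b c d = - Alt f a b c d := by
  simp only [Alt]; abel

section
variable {K : Type*} [Field K] {L : Type*} [LieRing L] [LieAlgebra K L]
    (φ : L →ₗ[K] L →ₗ[K] K)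

/-- four-term identity -/
theorem four (h2 : (2 : K) ≠ 0) (hsymm : ∀ x y : L, φ x y = φ y x)
    (hcoc : ∀ x y z : L, φ ⁅x, y⁆ z + φ ⁅z, x⁆ y + φ ⁅y, z⁆ x = 0) (p q r s : L) :
    φ ⁅p, q⁆ ⁅r, s⁆ - φ ⁅p, r⁆ ⁅q, s⁆ + φ ⁅p, s⁆ ⁅q, r⁆ = 0 := by
  have J : ∀ a b c t : L, φ ⁅a, ⁅b, c⁆⁆ t = φ ⁅b, ⁅a, c⁆⁆ t + φ ⁅⁅a, b⁆, c⁆ t := by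
    intro a b c t
    rw [leibniz_lie a b c]; simp [add_comm]
  have sk : ∀ a b t : L, φ ⁅a, b⁆ t = - φ ⁅b, a⁆ t := by
    intro a b t
    rw [← lie_skew a b]; simp only [map_neg, LinearMap.neg_apply]
  have C : ∀ a b c d : L, φ ⁅a, b⁆ ⁅c, d⁆ = φ ⁅a, ⁅c, d⁆⁆ b - φ ⁅b, ⁅c, d⁆⁆ a := by
    intro a b c d
    have := hcoc a b ⁅c, d⁆
    rw [sk ⁅c, d⁆ a] at this
    linear_combination this
  have JJ : ∀ a b c t : L, φ ⁅a, ⁅b, c⁆⁆ t - φ ⁅b, ⁅a, c⁆⁆ t + φ ⁅c, ⁅a, b⁆⁆ t = 0 := by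
    intro a b c t
    have h1 := J a b c t
    have h2 := sk ⁅a, b⁆ c t
    linear_combination h1 + h2
  apply mul_left_cancel₀ h2
  have a1 := C p q r s
  have a2 := C r s p q
  have b1 := C p r q s
  have b2 := C q s p r
  have c1 := C p s q r
  have c2 := C q r p s
  rw [hsymm] at a2 b2 c2
  linear_combination a1 + a2 - b1 - b2 + c1 + c2 - JJ q r s p + JJ p r s q - JJ p q s r + JJ p q r s

variable (y z : L)

def W (y z : L) := Alt fun a b c d : L => φ ⁅⁅a, b⁆, ⁅⁅c, d⁆, y⁆⁆ z
def cc (y z : L) := Alt fun a b c d : L => φ ⁅a, b⁆ ⁅⁅c, y⁆, ⁅d, z⁆⁆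
def pp (y z : L) := Alt fun a b c d : L => φ ⁅⁅a, b⁆, ⁅c, y⁆⁆ ⁅d, z⁆
def G (y z : L) := Alt fun a b c d : L => φ ⁅⁅a, b⁆, z⁆ ⁅⁅c, d⁆, y⁆
def M (y z : L) := Alt fun a b c d : L => φ ⁅a, b⁆ ⁅⁅⁅c, d⁆, y⁆, z⁆
def R (y z : L) := Alt fun a b c d : L => φ ⁅⁅⁅a, b⁆, y⁆, ⁅c, z⁆⁆ d
def N (y z : L) := Alt fun a b c d : L => φ ⁅⁅⁅a, b⁆, ⁅c, y⁆⁆, z⁆ d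

variable (hsymm : ∀ x y : L, φ x y = φ y x)
    (hcoc : ∀ x y z : L, φ ⁅x, y⁆ z + φ ⁅z, x⁆ y + φ ⁅y, z⁆ x = 0)
    (hP : ∀ p q r s : L, φ ⁅p, q⁆ ⁅r, s⁆ - φ ⁅p, r⁆ ⁅q, s⁆ + φ ⁅p, s⁆ ⁅q, r⁆ = 0)

theorem S_W (a b c d : L) :
    W φ y z a b c d = 4 * φ (Alt (fun a b c d => ⁅⁅⁅⁅y, a⁆, b⁆, c⁆, d⁆) a b c d) z := by
  have h : ∀ a b c d : L, φ ⁅⁅a, b⁆, ⁅⁅c, d⁆, y⁆⁆ z -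
      (φ ⁅⁅⁅⁅y, d⁆, c⁆, b⁆, a⁆ z - φ ⁅⁅⁅⁅y, c⁆, d⁆, b⁆, a⁆ z
      - φ ⁅⁅⁅⁅y, d⁆, c⁆, a⁆, b⁆ z + φ ⁅⁅⁅⁅y, c⁆, d⁆, a⁆, b⁆ z) = 0 := by
    intro a b c d
    have e : ∀ u v w : L, ⁅⁅u, v⁆, w⁆ = ⁅⁅w, v⁆, u⁆ - ⁅⁅w, u⁆, v⁆ := by
      intro u v w
      rw [lie_lie, ← lie_skew u, ← lie_skew v w, ← lie_skew v, ← lie_skew u w]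
      simp only [neg_lie, neg_neg]
    rw [e a b, e c d]
    simp only [sub_lie, map_sub, LinearMap.sub_apply]
    ring
  have H := alt_lift h a b c d
  have e : φ (Alt (fun a b c d => ⁅⁅⁅⁅y, a⁆, b⁆, c⁆, d⁆) a b c d) z
     = Alt (fun a b c d => φ ⁅⁅⁅⁅y, a⁆, b⁆, c⁆, d⁆ z) a b c d := by
    simp only [Alt, map_add, map_sub, LinearMap.add_apply, LinearMap.sub_apply]
  rw [e]
  simp only [alt_add, alt_sub] at H
  have k1 := pm4321 (fun a b c d => φ ⁅⁅⁅⁅y, a⁆, b⁆, c⁆, d⁆ z) a b c d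
  have k2 := pm3421 (fun a b c d => φ ⁅⁅⁅⁅y, a⁆, b⁆, c⁆, d⁆ z) a b c d
  have k3 := pm4312 (fun a b c d => φ ⁅⁅⁅⁅y, a⁆, b⁆, c⁆, d⁆ z) a b c d
  have k4 := pm3412 (fun a b c d => φ ⁅⁅⁅⁅y, a⁆, b⁆, c⁆, d⁆ z) a b c d
  beta_reduce at k1 k2 k3 k4
  simp only [W]
  linear_combination H + k1 - k2 - k3 + k4

include hsymm hP in
theorem L2 (a b c d : L) : 2 * cc φ y z a b c d + G φ y z a b c d = 0 := by
  have h1 : ∀ a b c d : L, φ ⁅a, b⁆ ⁅⁅c, y⁆, ⁅d, z⁆⁆ - φ ⁅b, ⁅d, z⁆⁆ ⁅a, ⁅c, y⁆⁆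
      + φ ⁅a, ⁅d, z⁆⁆ ⁅b, ⁅c, y⁆⁆ = 0 := by
    intro a b c d
    rw [hsymm ⁅b, ⁅d, z⁆⁆]
    exact hP a b ⁅c, y⁆ ⁅d, z⁆
  have h : ∀ a b c d : L, φ ⁅⁅a, b⁆, z⁆ ⁅⁅c, d⁆, y⁆ -
      (φ ⁅a, ⁅b, z⁆⁆ ⁅c, ⁅d, y⁆⁆ - φ ⁅a, ⁅b, z⁆⁆ ⁅d, ⁅c, y⁆⁆ - φ ⁅b, ⁅a, z⁆⁆ ⁅c, ⁅d, y⁆⁆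
       + φ ⁅b, ⁅a, z⁆⁆ ⁅d, ⁅c, y⁆⁆) = 0 := by
    intro a b c d
    rw [lie_lie, lie_lie]
    simp only [map_sub, LinearMap.sub_apply]
    ring
  have H := alt_lift h a b c d
  have H1 := alt_lift h1 a b c d
  simp only [alt_add, alt_sub] at H H1
  let f := fun a b c d : L => φ ⁅a, ⁅b, z⁆⁆ ⁅c, ⁅d, y⁆⁆
  have k1 := pm2413 f a b c d
  have k2 := pm1423 f a b c d
  have k3 := pm1243 f a b c d
  have k4 := pm2134 f a b c d
  have k5 := pm2143 f a b c d
  simp only [f] at k1 k2 k3 k4 k5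
  simp only [cc, G]
  linear_combination 2 * H1 + H + 2 * k1 - 2 * k2 - k3 - k4 + k5

include hsymm hP in
theorem L3 (h3 : (3 : K) ≠ 0) (a b c d : L) : M φ y z a b c d = 2 * cc φ y z a b c d := by
  have h1 : ∀ a b c d : L, φ ⁅a, b⁆ ⁅c, ⁅⁅d, y⁆, z⁆⁆ - φ ⁅a, c⁆ ⁅b, ⁅⁅d, y⁆, z⁆⁆
     + φ ⁅b, c⁆ ⁅a, ⁅⁅d, y⁆, z⁆⁆ = 0 := by
    intro a b c d
    rw [hsymm ⁅b, c⁆]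
    exact hP a b c ⁅⁅d, y⁆, z⁆
  have h : ∀ a b c d : L, φ ⁅a, b⁆ ⁅c, ⁅⁅d, y⁆, z⁆⁆ -
      (φ ⁅a, b⁆ ⁅⁅c, ⁅d, y⁆⁆, z⁆ + φ ⁅a, b⁆ ⁅⁅d, y⁆, ⁅c, z⁆⁆) = 0 := by
    intro a b c d
    rw [leibniz_lie c]
    simp only [map_add]; ring
  have h' : ∀ a b c d : L, φ ⁅a, b⁆ ⁅⁅⁅c, d⁆, y⁆, z⁆ -
      (φ ⁅a, b⁆ ⁅⁅c, ⁅d, y⁆⁆, z⁆ - φ ⁅a, b⁆ ⁅⁅d, ⁅c, y⁆⁆, z⁆) = 0 := by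
    intro a b c d
    rw [lie_lie c d y]
    simp only [sub_lie, map_sub]; ring
  have H1 := alt_lift h1 a b c d
  have H := alt_lift h a b c d
  have H' := alt_lift h' a b c d
  simp only [alt_add, alt_sub] at H H1 H'
  have k1 := pm1324 (fun a b c d => φ ⁅a, b⁆ ⁅c, ⁅⁅d, y⁆, z⁆⁆) a b c d
  have k2 := pm2314 (fun a b c d => φ ⁅a, b⁆ ⁅c, ⁅⁅d, y⁆, z⁆⁆) a b c d
  have k3 := pm1243 (fun a b c d => φ ⁅a, b⁆ ⁅⁅c, y⁆, ⁅d, z⁆⁆) a b c d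
  have k4 := pm1243 (fun a b c d => φ ⁅a, b⁆ ⁅⁅c, ⁅d, y⁆⁆, z⁆) a b c d
  beta_reduce at k1 k2 k3 k4
  apply mul_left_cancel₀ h3
  simp only [cc, M]
  linear_combination 2 * H1 + 2 * k1 - 2 * k2 - 6 * H - 6 * k3 + 3 * H' - 3 * k4

include hsymm hcoc in
theorem L4 (a b c d : L) : W φ y z a b c d + M φ y z a b c d - G φ y z a b c d = 0 := by
  have h : ∀ a b c d : L, φ ⁅⁅a, b⁆, ⁅⁅c, d⁆, y⁆⁆ z + φ ⁅a, b⁆ ⁅⁅⁅c, d⁆, y⁆, z⁆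
      - φ ⁅⁅a, b⁆, z⁆ ⁅⁅c, d⁆, y⁆ = 0 := by
    intro a b c d
    have := hcoc ⁅a, b⁆ ⁅⁅c, d⁆, y⁆ z
    rw [← lie_skew z, hsymm _ ⁅a, b⁆, map_neg, LinearMap.neg_apply] at this
    linear_combination this
  have H := alt_lift h a b c d
  simp only [alt_add, alt_sub] at H
  exact H

theorem alt_jac (h3 : (3 : K) ≠ 0) (F : L → L → K)
    (hF : ∀ u v w d, u + v + w = 0 → F u d + F v d + F w d = 0) (a b c d : L) :
    Alt (fun a b c d => F ⁅a, ⁅b, c⁆⁆ d) a b c d = 0 := by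
  have H := alt_lift (fun a b c d => hF _ _ _ d (lie_jacobi a b c)) a b c d
  simp only [alt_add] at H
  have k1 := pm2314 (fun a b c d => F ⁅a, ⁅b, c⁆⁆ d) a b c d
  have k2 := pm3124 (fun a b c d => F ⁅a, ⁅b, c⁆⁆ d) a b c d
  beta_reduce at k1 k2
  apply mul_left_cancel₀ h3
  linear_combination H - k1 - k2

include hcoc in
theorem L5 (h3 : (3 : K) ≠ 0) (a b c d : L) :
    2 * R φ y z a b c d + G φ y z a b c d - 2 * pp φ y z a b c d = 0 := by
  have h : ∀ a b c d : L, φ ⁅⁅⁅a, b⁆, y⁆, ⁅c, z⁆⁆ d - φ ⁅d, ⁅c, z⁆⁆ ⁅⁅a, b⁆, y⁆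
      + φ ⁅d, ⁅⁅a, b⁆, y⁆⁆ ⁅c, z⁆ = 0 := by
    intro a b c d
    have := hcoc ⁅⁅a, b⁆, y⁆ ⁅c, z⁆ d
    rw [← lie_skew _ d, map_neg, LinearMap.neg_apply] at this
    linear_combination this
  have h1 : ∀ a b c d : L, φ ⁅⁅a, b⁆, z⁆ ⁅⁅c, d⁆, y⁆ -
      (φ ⁅a, ⁅b, z⁆⁆ ⁅⁅c, d⁆, y⁆ - φ ⁅b, ⁅a, z⁆⁆ ⁅⁅c, d⁆, y⁆) = 0 := by
    intro a b c d
    rw [lie_lie a b z]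
    simp only [map_sub, LinearMap.sub_apply]
    ring
  have h2 : ∀ a b c d : L, φ ⁅a, ⁅⁅b, c⁆, y⁆⁆ ⁅d, z⁆ -
      (φ ⁅⁅b, c⁆, ⁅a, y⁆⁆ ⁅d, z⁆ + φ ⁅⁅a, ⁅b, c⁆⁆, y⁆ ⁅d, z⁆) = 0 := by
    intro a b c d
    rw [leibniz_lie a]
    simp only [map_add, LinearMap.add_apply]
    ring
  have Z := alt_jac h3 (fun u d => φ ⁅u, y⁆ ⁅d, z⁆) (by
    intro u v w d h
    simp only [← LinearMap.add_apply, ← map_add, ← add_lie, h, zero_lie, map_zero,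
      LinearMap.zero_apply]) a b c d
  have H := alt_lift h a b c d
  have H1 := alt_lift h1 a b c d
  have H2 := alt_lift h2 a b c d
  simp only [alt_add, alt_sub] at H H1 H2
  have k1 := pm4312 (fun a b c d => φ ⁅a, ⁅b, z⁆⁆ ⁅⁅c, d⁆, y⁆) a b c d
  have k2 := pm2134 (fun a b c d => φ ⁅a, ⁅b, z⁆⁆ ⁅⁅c, d⁆, y⁆) a b c d
  have k3 := pm4123 (fun a b c d => φ ⁅a, ⁅⁅b, c⁆, y⁆⁆ ⁅d, z⁆) a b c d
  have k4 := pm2314 (fun a b c d => φ ⁅⁅a, b⁆, ⁅c, y⁆⁆ ⁅d, z⁆) a b c d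
  beta_reduce at k1 k2 k3 k4
  simp only [R, G, pp]
  linear_combination 2 * H + 2 * k1 + H1 - k2 - 2 * k3 + 2 * H2 + 2 * k4 + 2 * Z

include hcoc in
theorem L6 (h3 : (3 : K) ≠ 0) (a b c d : L) :
    M φ y z a b c d = 2 * N φ y z a b c d + 2 * R φ y z a b c d := by
  have h : ∀ a b c d : L, φ ⁅a, b⁆ ⁅⁅⁅c, d⁆, y⁆, z⁆ - φ ⁅a, ⁅⁅⁅c, d⁆, y⁆, z⁆⁆ b
      + φ ⁅b, ⁅⁅⁅c, d⁆, y⁆, z⁆⁆ a = 0 := by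
    intro a b c d
    have := hcoc a b ⁅⁅⁅c, d⁆, y⁆, z⁆
    rw [← lie_skew _ a, map_neg, LinearMap.neg_apply] at this
    linear_combination this
  have h1 : ∀ a b c d : L, φ ⁅a, ⁅⁅⁅b, c⁆, y⁆, z⁆⁆ d - (φ ⁅⁅⁅b, c⁆, ⁅a, y⁆⁆, z⁆ d
      + φ ⁅⁅⁅b, c⁆, y⁆, ⁅a, z⁆⁆ d + φ ⁅⁅⁅a, ⁅b, c⁆⁆, y⁆, z⁆ d) = 0 := by
    intro a b c d
    rw [leibniz_lie a, leibniz_lie a ⁅b, c⁆ y]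
    simp only [map_add, add_lie, LinearMap.add_apply]
    ring
  have Z := alt_jac h3 (fun u d => φ ⁅⁅u, y⁆, z⁆ d) (by
    intro u v w d h
    simp only [← LinearMap.add_apply, ← map_add, ← add_lie, h, zero_lie, map_zero,
      LinearMap.zero_apply]) a b c d
  have H := alt_lift h a b c d
  have H1 := alt_lift h1 a b c d
  simp only [alt_add, alt_sub] at H H1
  have k1 := pm1342 (fun a b c d => φ ⁅a, ⁅⁅⁅b, c⁆, y⁆, z⁆⁆ d) a b c d
  have k2 := pm2341 (fun a b c d => φ ⁅a, ⁅⁅⁅b, c⁆, y⁆, z⁆⁆ d) a b c d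
  have k3 := pm2314 (fun a b c d => φ ⁅⁅⁅a, b⁆, ⁅c, y⁆⁆, z⁆ d) a b c d
  have k4 := pm2314 (fun a b c d => φ ⁅⁅⁅a, b⁆, y⁆, ⁅c, z⁆⁆ d) a b c d
  beta_reduce at k1 k2 k3 k4
  simp only [R, M, N]
  linear_combination H + k1 - k2 + 2 * H1 + 2 * k3 + 2 * k4 + 2 * Z

include hsymm hcoc in
theorem L7 (h3 : (3 : K) ≠ 0) (a b c d : L) :
    W φ y z a b c d = 2 * N φ y z a b c d - 2 * pp φ y z a b c d := by
  have h : ∀ a b c d : L, φ ⁅a, ⁅⁅b, c⁆, ⁅d, y⁆⁆⁆ z + φ ⁅⁅⁅b, c⁆, ⁅d, y⁆⁆, z⁆ a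
      - φ ⁅⁅b, c⁆, ⁅d, y⁆⁆ ⁅a, z⁆ = 0 := by
    intro a b c d
    have := hcoc a ⁅⁅b, c⁆, ⁅d, y⁆⁆ z
    rw [← lie_skew z a, map_neg, LinearMap.neg_apply, hsymm ⁅a, z⁆] at this
    linear_combination this
  have h1 : ∀ a b c d : L, φ ⁅a, ⁅⁅b, c⁆, ⁅d, y⁆⁆⁆ z - (φ ⁅⁅b, c⁆, ⁅a, ⁅d, y⁆⁆⁆ z
      + φ ⁅⁅a, ⁅b, c⁆⁆, ⁅d, y⁆⁆ z) = 0 := by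
    intro a b c d
    rw [leibniz_lie a]
    simp only [map_add, LinearMap.add_apply]
    ring
  have h2 : ∀ a b c d : L, φ ⁅⁅a, b⁆, ⁅⁅c, d⁆, y⁆⁆ z - (φ ⁅⁅a, b⁆, ⁅c, ⁅d, y⁆⁆⁆ z
      - φ ⁅⁅a, b⁆, ⁅d, ⁅c, y⁆⁆⁆ z) = 0 := by
    intro a b c d
    rw [lie_lie c d y]
    simp only [map_sub, lie_sub, LinearMap.sub_apply]
    ring
  have Z := alt_jac h3 (fun u d => φ ⁅u, ⁅d, y⁆⁆ z) (by
    intro u v w d h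
    simp only [← LinearMap.add_apply, ← map_add, ← add_lie, h, zero_lie, map_zero,
      LinearMap.zero_apply]) a b c d
  have H := alt_lift h a b c d
  have H1 := alt_lift h1 a b c d
  have H2 := alt_lift h2 a b c d
  simp only [alt_add, alt_sub] at H H1 H2
  have k1 := pm2314 (fun a b c d => φ ⁅⁅a, b⁆, ⁅c, ⁅d, y⁆⁆⁆ z) a b c d
  have k2 := pm1243 (fun a b c d => φ ⁅⁅a, b⁆, ⁅c, ⁅d, y⁆⁆⁆ z) a b c d
  have k3 := pm2341 (fun a b c d => φ ⁅⁅⁅a, b⁆, ⁅c, y⁆⁆, z⁆ d) a b c d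
  have k4 := pm2341 (fun a b c d => φ ⁅⁅a, b⁆, ⁅c, y⁆⁆ ⁅d, z⁆) a b c d
  beta_reduce at k1 k2 k3 k4
  simp only [W, N, pp]
  linear_combination 2 * H - 2 * k3 + 2 * k4 + H2 - k2 - 2 * H1 - 2 * k1 - 2 * Z

include hsymm hcoc in
theorem L8 (a b c d : L) :
    pp φ y z a b c d + pp φ z y a b c d + cc φ y z a b c d = 0 := by
  have h : ∀ a b c d : L, φ ⁅⁅a, b⁆, ⁅c, y⁆⁆ ⁅d, z⁆ + φ ⁅a, b⁆ ⁅⁅c, y⁆, ⁅d, z⁆⁆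
      - φ ⁅⁅a, b⁆, ⁅d, z⁆⁆ ⁅c, y⁆ = 0 := by
    intro a b c d
    have := hcoc ⁅a, b⁆ ⁅c, y⁆ ⁅d, z⁆
    rw [← lie_skew ⁅d, z⁆ ⁅a, b⁆, map_neg, LinearMap.neg_apply, hsymm _ ⁅a, b⁆] at this
    linear_combination this
  have H := alt_lift h a b c d
  simp only [alt_add, alt_sub] at H
  have k1 := pm1243 (fun a b c d => φ ⁅⁅a, b⁆, ⁅c, z⁆⁆ ⁅d, y⁆) a b c d
  beta_reduce at k1
  simp only [pp, cc]
  linear_combination H + k1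

theorem L9 (a b c d : L) : cc φ z y a b c d = cc φ y z a b c d := by
  have h : ∀ a b c d : L, φ ⁅a, b⁆ ⁅⁅c, z⁆, ⁅d, y⁆⁆ + φ ⁅a, b⁆ ⁅⁅d, y⁆, ⁅c, z⁆⁆ = 0 := by
    intro a b c d
    rw [← lie_skew ⁅c, z⁆, map_neg]
    ring
  have H := alt_lift h a b c d
  simp only [alt_add] at H
  have k1 := pm1243 (fun a b c d => φ ⁅a, b⁆ ⁅⁅c, y⁆, ⁅d, z⁆⁆) a b c d
  beta_reduce at k1
  simp only [cc]
  linear_combination H - k1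

include hsymm hcoc in
theorem S_zero (h2 : (2 : K) ≠ 0) (h3 : (3 : K) ≠ 0) (a b c d : L) :
    φ (Alt (fun a b c d => ⁅⁅⁅⁅y, a⁆, b⁆, c⁆, d⁆) a b c d) z = 0 := by
  have hP := four φ h2 hsymm hcoc
  have h4 : (4 : K) ≠ 0 := by
    have : (4 : K) = 2 * 2 := by norm_num
    rw [this]; exact mul_ne_zero h2 h2
  have key : ∀ y z : L, W φ y z a b c d = -4 * cc φ y z a b c d ∧
      cc φ y z a b c d = pp φ y z a b c d := by
    intro y z
    have e2 := L2 φ y z hsymm hP a b c d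
    have e3 := L3 φ y z hsymm hP h3 a b c d
    have e4 := L4 φ y z hsymm hcoc a b c d
    have e5 := L5 φ y z hcoc h3 a b c d
    have e6 := L6 φ y z hcoc h3 a b c d
    have e7 := L7 φ y z hsymm hcoc h3 a b c d
    have w1 : W φ y z a b c d = -4 * cc φ y z a b c d := by
      linear_combination e4 - e3 + e2
    refine ⟨w1, ?_⟩
    apply mul_left_cancel₀ h4
    linear_combination w1 - e7 + e6 - e3 + e5 - e2
  have e8 := L8 φ y z hsymm hcoc a b c d
  have e9 := L9 φ y z a b c d
  have c0 : cc φ y z a b c d = 0 := by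
    apply mul_left_cancel₀ h3
    linear_combination e8 + (key y z).2 + (key z y).2 - e9
  have w := (key y z).1
  rw [S_W, c0] at w
  apply mul_left_cancel₀ h4
  linear_combination w

end

theorem alt_lie {L : Type*} [LieRing L] (y w : L) (a b c d : L) :
    ⁅w, Alt (fun a b c d => ⁅⁅⁅⁅y, a⁆, b⁆, c⁆, d⁆) a b c d⁆ =
      Alt (fun a b c d => ⁅⁅⁅⁅⁅w, y⁆, a⁆, b⁆, c⁆, d⁆) a b c d +
      Alt (fun a b c d => ⁅⁅⁅⁅y, a⁆, b⁆, c⁆, d⁆) ⁅w, a⁆ b c d +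
      Alt (fun a b c d => ⁅⁅⁅⁅y, a⁆, b⁆, c⁆, d⁆) a ⁅w, b⁆ c d +
      Alt (fun a b c d => ⁅⁅⁅⁅y, a⁆, b⁆, c⁆, d⁆) a b ⁅w, c⁆ d +
      Alt (fun a b c d => ⁅⁅⁅⁅y, a⁆, b⁆, c⁆, d⁆) a b c ⁅w, d⁆ := by
  obtain ⟨f, hf⟩ : ∃ f : L → L → L → L → L → L, f = fun y a b c d => ⁅⁅⁅⁅y, a⁆, b⁆, c⁆, d⁆ :=
    ⟨_, rfl⟩
  have hw : ∀ a b c d, ⁅w, f y a b c d⁆ = f ⁅w, y⁆ a b c d + f y ⁅w, a⁆ b c d + f y a ⁅w, b⁆ c d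
      + f y a b ⁅w, c⁆ d + f y a b c ⁅w, d⁆ := by
    intro a b c d
    rw [hf]
    beta_reduce
    rw [leibniz_lie w, leibniz_lie w ⁅⁅y, a⁆, b⁆, leibniz_lie w ⁅y, a⁆, leibniz_lie w y]
    simp only [add_lie]
  have e : ∀ y, (fun a b c d => ⁅⁅⁅⁅y, a⁆, b⁆, c⁆, d⁆) = f y := by intro y; rw [hf]
  rw [e, e]
  simp only [Alt, lie_add, lie_sub, hw]
  abel

def SI (K : Type*) [Field K] (L : Type*) [LieRing L] [LieAlgebra K L] : LieIdeal K L :=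
  { Submodule.span K {s : L | ∃ y a b c d : L,
      s = Alt (fun a b c d => ⁅⁅⁅⁅y, a⁆, b⁆, c⁆, d⁆) a b c d} with
    lie_mem := by
      intro w m hm
      change m ∈ Submodule.span K _ at hm
      change ⁅w, m⁆ ∈ Submodule.span K _
      induction hm using Submodule.span_induction with
      | mem x hx =>
        obtain ⟨y, a, b, c, d, rfl⟩ := hx
        rw [alt_lie]
        refine add_mem (add_mem (add_mem (add_mem ?_ ?_) ?_) ?_) ?_ <;>
          exact Submodule.subset_span ⟨_, _, _, _, _, rfl⟩
      | zero => rw [lie_zero]; exact zero_mem _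
      | add x y _ _ hx hy => rw [lie_add]; exact add_mem hx hy
      | smul r x _ hx => rw [lie_smul]; exact Submodule.smul_mem _ r hx }

end CocAux

/-- A Lie algebra over a field of characteristic `≠ 2, 3` possessing a nonzero
commutative 2-cocycle has a nonzero homomorphic image (a quotient by a proper ideal) satisfying
the standard identity of degree 5. -/
theorem nonzero_cocycle_gives_image_satisfying_standard_identity
    (K : Type*) [Field K] (h2 : (2 : K) ≠ 0) (h3 : (3 : K) ≠ 0)
    (L : Type*) [LieRing L] [LieAlgebra K L]
    (φ : L →ₗ[K] L →ₗ[K] K)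
    (hsymm : ∀ x y : L, φ x y = φ y x)
    (hcoc : ∀ x y z : L, φ ⁅x, y⁆ z + φ ⁅z, x⁆ y + φ ⁅y, z⁆ x = 0)
    (hne : φ ≠ 0) :
    ∃ I : LieIdeal K L, I ≠ ⊤ ∧
      ∀ (y : L ⧸ I) (x : Fin 4 → L ⧸ I),
        ∑ σ : Equiv.Perm (Fin 4), (Equiv.Perm.sign σ : ℤ) •
          ⁅⁅⁅⁅y, x (σ 0)⁆, x (σ 1)⁆, x (σ 2)⁆, x (σ 3)⁆ = 0 := by
  refine ⟨CocAux.SI K L, ?_, ?_⟩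
  · intro htop
    apply hne
    ext u v
    have hu : u ∈ CocAux.SI K L := by rw [htop]; exact LieSubmodule.mem_top u
    change u ∈ Submodule.span K _ at hu
    have hle : Submodule.span K {s : L | ∃ y a b c d : L,
        s = CocAux.Alt (fun a b c d => ⁅⁅⁅⁅y, a⁆, b⁆, c⁆, d⁆) a b c d} ≤ LinearMap.ker φ := by
      rw [Submodule.span_le]
      rintro s ⟨y, a, b, c, d, rfl⟩
      rw [SetLike.mem_coe, LinearMap.mem_ker]
      ext z
      exact CocAux.S_zero φ y z hsymm hcoc h2 h3 a b c d
    have := hle hu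
    rw [LinearMap.mem_ker] at this
    rw [this]
    rfl
  · intro y x
    rw [CocAux.sum_eq_alt (fun a b c d => ⁅⁅⁅⁅y, a⁆, b⁆, c⁆, d⁆) x]
    have hs : ∀ t : L ⧸ CocAux.SI K L, ∃ s : L, LieSubmodule.Quotient.mk s = t :=
      fun t => LieSubmodule.Quotient.surjective_mk' _ t
    obtain ⟨y, rfl⟩ := hs y
    obtain ⟨a, ha⟩ := hs (x 0)
    obtain ⟨b, hb⟩ := hs (x 1)
    obtain ⟨c, hc⟩ := hs (x 2)
    obtain ⟨d, hd⟩ := hs (x 3)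
    rw [← ha, ← hb, ← hc, ← hd]
    have hm : CocAux.Alt (fun a b c d => ⁅⁅⁅⁅y, a⁆, b⁆, c⁆, d⁆) a b c d ∈ CocAux.SI K L :=
      Submodule.subset_span ⟨y, a, b, c, d, rfl⟩
    have := (LieSubmodule.Quotient.mk_eq_zero (N := CocAux.SI K L)).2 hm
    rw [← this]
    simp only [CocAux.Alt, ← LieSubmodule.Quotient.mk_bracket]
    rfl
end

section
/- Let L be a Lie algebra over a field K of characteristic different from 2 and 3 which has a Lie subalgebra S of codimension 1 (i.e. dim_K(L/S) = 1 as vector spaces) such that S is not an ideal of L. Then L possesses a nonzero commutative 2-cocycle. -/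
/-- A Lie algebra over a field of characteristic `≠ 2, 3` with a Lie
subalgebra of codimension 1 which is not an ideal possesses a nonzero commutative 2-cocycle. -/
theorem codim_one_subalgebra_gives_nonzero_cocycle
    (K : Type*) [Field K] (h2 : (2 : K) ≠ 0) (h3 : (3 : K) ≠ 0)
    (L : Type*) [LieRing L] [LieAlgebra K L]
    (S : LieSubalgebra K L)
    (hcodim : Module.finrank K (L ⧸ S.toSubmodule) = 1)
    (hni : ¬ ∀ x y : L, y ∈ S → ⁅x, y⁆ ∈ S) :
    ∃ φ : L →ₗ[K] L →ₗ[K] K,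
      (∀ x y : L, φ x y = φ y x) ∧
      (∀ x y z : L, φ ⁅x, y⁆ z + φ ⁅z, x⁆ y + φ ⁅y, z⁆ x = 0) ∧
      φ ≠ 0 := by
  have hfin : Module.Finite K (L ⧸ S.toSubmodule) :=
    Module.finite_of_finrank_pos (by omega)
  let e : (L ⧸ S.toSubmodule) ≃ₗ[K] K :=
    LinearEquiv.ofFinrankEq _ _ (by rw [hcodim, Module.finrank_self])
  obtain ⟨f, hf⟩ : ∃ f : L →ₗ[K] K, f = e.toLinearMap ∘ₗ S.toSubmodule.mkQ := ⟨_, rfl⟩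
  have hker : ∀ x, f x = 0 ↔ x ∈ S := by
    intro x
    simp [hf, Submodule.Quotient.mk_eq_zero]
  obtain ⟨v, hv⟩ : ∃ v, f v = 1 := by
    obtain ⟨v, hv⟩ := S.toSubmodule.mkQ_surjective (e.symm 1)
    exact ⟨v, by rw [hf, LinearMap.comp_apply, hv]; simp⟩
  obtain ⟨g, hg⟩ : ∃ g : L →ₗ[K] K, ∀ x, g x = f ⁅x, v⁆ := by
    refine ⟨-(f ∘ₗ (LieAlgebra.ad K L v : L →ₗ[K] L)), fun x => ?_⟩
    rw [← lie_skew x v, map_neg]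
    rfl
  have hfb : ∀ x y, f ⁅x, y⁆ = f y * g x - f x * g y := by
    intro x y
    have hs : x - f x • v ∈ S := by rw [← hker]; simp [hv]
    have ht : y - f y • v ∈ S := by rw [← hker]; simp [hv]
    have h := (hker _).2 (S.lie_mem hs ht)
    simp only [lie_sub, sub_lie, lie_smul, smul_lie, lie_self, map_sub, map_smul, smul_eq_mul,
      smul_zero, map_zero] at h
    rw [← lie_skew v y, map_neg, ← hg, ← hg] at h
    linear_combination h
  have hgb : ∀ x y, g ⁅x, y⁆ = f y * g ⁅x, v⁆ - f x * g ⁅y, v⁆ := by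
    intro x y
    rw [hg, lie_lie, map_sub, hfb x ⁅y, v⁆, hfb y ⁅x, v⁆, ← hg x, ← hg y]
    ring
  refine ⟨LinearMap.mk₂ K (fun x y => f x * g y + f y * g x) ?_ ?_ ?_ ?_, ?_, ?_, ?_⟩
  · intros; simp only [map_add]; ring
  · intros; simp only [map_smul, smul_eq_mul]; ring
  · intros; simp only [map_add]; ring
  · intros; simp only [map_smul, smul_eq_mul]; ring
  · intro x y; simp only [LinearMap.mk₂_apply]; ring
  · intro x y z
    simp only [LinearMap.mk₂_apply]
    rw [hgb x y, hgb z x, hgb y z, hfb x y, hfb z x, hfb y z]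
    ring
  · intro h0
    apply hni
    intro x y hy
    have hy0 := (hker y).2 hy
    have h := congrArg (fun φ : L →ₗ[K] L →ₗ[K] K => φ v y) h0
    simp only [LinearMap.mk₂_apply, hv, hy0, LinearMap.zero_apply] at h
    rw [← hker, hfb, hy0]
    linear_combination (-f x) * h
end

section
/- Let L be a simple Lie algebra over a field K of characteristic different from 2 and 3. Then L possesses a nonzero commutative 2-cocycle if and only if L satisfies the standard identity of degree 5. -/
open Finset


def Fc {L : Type*} [LieRing L] (a b u v : L) : L :=
  ⁅u, ⁅v, ⁅a, b⁆⁆⁆ + ⁅v, ⁅u, ⁅a, b⁆⁆⁆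
    - (⁅u, ⁅⁅a, b⁆, v⁆⁆ + ⁅b, ⁅⁅u, a⁆, v⁆⁆ + ⁅a, ⁅⁅b, u⁆, v⁆⁆)
    - (⁅v, ⁅⁅a, b⁆, u⁆⁆ + ⁅b, ⁅⁅v, a⁆, u⁆⁆ + ⁅a, ⁅⁅b, v⁆, u⁆⁆)

def S5 {L : Type*} [LieRing L] (a b c d y : L) : L :=
  ⁅⁅a, b⁆, ⁅⁅c, d⁆, y⁆⁆ + ⁅⁅c, d⁆, ⁅⁅a, b⁆, y⁆⁆
      - (⁅⁅a, c⁆, ⁅⁅b, d⁆, y⁆⁆ + ⁅⁅b, d⁆, ⁅⁅a, c⁆, y⁆⁆)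
      + (⁅⁅a, d⁆, ⁅⁅b, c⁆, y⁆⁆ + ⁅⁅b, c⁆, ⁅⁅a, d⁆, y⁆⁆)

theorem Fc_cocycle {L : Type*} [LieRing L] (a b u v w : L) :
    Fc a b ⁅u, v⁆ w + Fc a b ⁅w, u⁆ v + Fc a b ⁅v, w⁆ u
      = -2 • S5 u v w b a + 2 • S5 u v w a b := by
  have hw : ∀ m : L, ⁅w, m⁆ = -⁅m, w⁆ := fun m => (lie_skew w m).symm
  simp only [Fc, S5, lie_lie, lie_sub, sub_lie, lie_neg, neg_lie, hw]
  abel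

theorem Fc_engel {L : Type*} [LieRing L] (a b : L) :
    Fc a b a a = 2 • ⁅a, ⁅a, ⁅a, b⁆⁆⁆ := by
  have hw : ∀ m : L, ⁅b, m⁆ = -⁅m, b⁆ := fun m => (lie_skew b m).symm
  simp only [Fc, lie_self, zero_lie, lie_zero, lie_lie, lie_sub, lie_neg, neg_lie, hw]
  abel

theorem Fc_symm {L : Type*} [LieRing L] (a b u v : L) : Fc a b u v = Fc a b v u := by
  unfold Fc; abel

theorem sum_perm_succ {M : Type*} [AddCommGroup M] {n : ℕ} (G : Equiv.Perm (Fin (n+1)) → M) :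
    ∑ σ, G σ = ∑ p, ∑ e, G (Equiv.Perm.decomposeFin.symm (p, e)) := by
  rw [← Equiv.sum_comp Equiv.Perm.decomposeFin.symm, Fintype.sum_prod_type]

theorem sum_perm_four {M : Type*} [AddCommGroup M] (G : Fin 4 → Fin 4 → Fin 4 → Fin 4 → M) :
    ∑ σ : Equiv.Perm (Fin 4), (Equiv.Perm.sign σ : ℤ) • G (σ 0) (σ 1) (σ 2) (σ 3)
    = G 0 1 2 3 + -G 0 1 3 2 + (-G 0 2 1 3 + G 0 2 3 1) + (-G 0 3 2 1 + G 0 3 1 2) +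
          (-G 1 0 2 3 + G 1 0 3 2 + (G 1 2 0 3 + -G 1 2 3 0) + (G 1 3 2 0 + -G 1 3 0 2)) +
        (-G 2 1 0 3 + G 2 1 3 0 + (G 2 0 1 3 + -G 2 0 3 1) + (G 2 3 0 1 + -G 2 3 1 0)) +
      (-G 3 1 2 0 + G 3 1 0 2 + (G 3 2 1 0 + -G 3 2 0 1) + (G 3 0 2 1 + -G 3 0 1 2)) := by
  have e2 : ∀ τ : Equiv.Perm (Fin 4), τ 2 = τ (Fin.succ 1) := fun _ => rfl
  have e3 : ∀ τ : Equiv.Perm (Fin 4), τ 3 = τ (Fin.succ 2) := fun _ => rfl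
  have e1 : ∀ τ : Equiv.Perm (Fin 4), τ 1 = τ (Fin.succ 0) := fun _ => rfl
  have f2 : ∀ τ : Equiv.Perm (Fin 3), τ 2 = τ (Fin.succ 1) := fun _ => rfl
  have f1 : ∀ τ : Equiv.Perm (Fin 3), τ 1 = τ (Fin.succ 0) := fun _ => rfl
  have g1 : ∀ τ : Equiv.Perm (Fin 2), τ 1 = τ (Fin.succ 0) := fun _ => rfl
  simp only [sum_perm_succ, Fin.sum_univ_four, Fin.sum_univ_three, Fin.sum_univ_two, 
    Equiv.Perm.decomposeFin.symm_sign, e1, e2, e3, f1, f2, g1, Equiv.Perm.decomposeFin_symm_apply_succ, Equiv.Perm.decomposeFin_symm_apply_zero,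
    Finset.univ_unique, Finset.sum_singleton]
  simp +decide [Equiv.swap_apply_def]

/-- The core computation: the standard polynomial lies in the kernel of every cocycle. -/
theorem cocycle_kills_standard {K L : Type*} [Field K] [LieRing L] [LieAlgebra K L]
    (h6 : (6 : K) ≠ 0) (φ : L →ₗ[K] L →ₗ[K] K)
    (H : ∀ x y z : L, φ ⁅x, y⁆ z - φ y ⁅x, z⁆ + φ x ⁅y, z⁆ = 0) (a b c d y z : L) :
    φ (⁅⁅a, b⁆, ⁅⁅c, d⁆, y⁆⁆ + ⁅⁅c, d⁆, ⁅⁅a, b⁆, y⁆⁆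
      - (⁅⁅a, c⁆, ⁅⁅b, d⁆, y⁆⁆ + ⁅⁅b, d⁆, ⁅⁅a, c⁆, y⁆⁆)
      + (⁅⁅a, d⁆, ⁅⁅b, c⁆, y⁆⁆ + ⁅⁅b, c⁆, ⁅⁅a, d⁆, y⁆⁆)) z = 0 := by
  refine (mul_eq_zero.mp ?_).resolve_left h6
  linear_combination (norm := skip)
      (-3 : K) * H a b ⁅c, ⁅d, ⁅y, z⁆⁆⁆
      + (2 : K) * H a b ⁅c, ⁅y, ⁅d, z⁆⁆⁆
      + (3 : K) * H a b ⁅d, ⁅c, ⁅y, z⁆⁆⁆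
      + (-2 : K) * H a b ⁅d, ⁅y, ⁅c, z⁆⁆⁆
      + (1 : K) * H a b ⁅y, ⁅c, ⁅d, z⁆⁆⁆
      + (-1 : K) * H a b ⁅y, ⁅d, ⁅c, z⁆⁆⁆
      + (3 : K) * H a c ⁅b, ⁅d, ⁅y, z⁆⁆⁆
      + (-2 : K) * H a c ⁅b, ⁅y, ⁅d, z⁆⁆⁆
      + (-3 : K) * H a c ⁅d, ⁅b, ⁅y, z⁆⁆⁆
      + (2 : K) * H a c ⁅d, ⁅y, ⁅b, z⁆⁆⁆
      + (-1 : K) * H a c ⁅y, ⁅b, ⁅d, z⁆⁆⁆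
      + (1 : K) * H a c ⁅y, ⁅d, ⁅b, z⁆⁆⁆
      + (1 : K) * H a ⁅b, c⁆ ⁅d, ⁅y, z⁆⁆
      + (1 : K) * H a ⁅b, c⁆ ⁅y, ⁅d, z⁆⁆
      + (-3 : K) * H a d ⁅b, ⁅c, ⁅y, z⁆⁆⁆
      + (2 : K) * H a d ⁅b, ⁅y, ⁅c, z⁆⁆⁆
      + (3 : K) * H a d ⁅c, ⁅b, ⁅y, z⁆⁆⁆
      + (-2 : K) * H a d ⁅c, ⁅y, ⁅b, z⁆⁆⁆
      + (1 : K) * H a d ⁅y, ⁅b, ⁅c, z⁆⁆⁆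
      + (-1 : K) * H a d ⁅y, ⁅c, ⁅b, z⁆⁆⁆
      + (-1 : K) * H a ⁅b, d⁆ ⁅c, ⁅y, z⁆⁆
      + (-1 : K) * H a ⁅b, d⁆ ⁅y, ⁅c, z⁆⁆
      + (1 : K) * H a ⁅c, d⁆ ⁅b, ⁅y, z⁆⁆
      + (1 : K) * H a ⁅c, d⁆ ⁅y, ⁅b, z⁆⁆
      + (-2 : K) * H a y ⁅b, ⁅c, ⁅d, z⁆⁆⁆
      + (2 : K) * H a y ⁅b, ⁅d, ⁅c, z⁆⁆⁆
      + (2 : K) * H a y ⁅c, ⁅b, ⁅d, z⁆⁆⁆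
      + (-2 : K) * H a y ⁅c, ⁅d, ⁅b, z⁆⁆⁆
      + (-2 : K) * H a y ⁅d, ⁅b, ⁅c, z⁆⁆⁆
      + (2 : K) * H a y ⁅d, ⁅c, ⁅b, z⁆⁆⁆
      + (1 : K) * H a ⁅b, y⁆ ⁅c, ⁅d, z⁆⁆
      + (-1 : K) * H a ⁅b, y⁆ ⁅d, ⁅c, z⁆⁆
      + (-1 : K) * H a ⁅c, y⁆ ⁅b, ⁅d, z⁆⁆
      + (1 : K) * H a ⁅c, y⁆ ⁅d, ⁅b, z⁆⁆
      + (-1 : K) * H a ⁅b, ⁅c, y⁆⁆ ⁅d, z⁆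
      + (1 : K) * H a ⁅c, ⁅b, y⁆⁆ ⁅d, z⁆
      + (1 : K) * H a ⁅d, y⁆ ⁅b, ⁅c, z⁆⁆
      + (-1 : K) * H a ⁅d, y⁆ ⁅c, ⁅b, z⁆⁆
      + (1 : K) * H a ⁅b, ⁅d, y⁆⁆ ⁅c, z⁆
      + (-1 : K) * H a ⁅d, ⁅b, y⁆⁆ ⁅c, z⁆
      + (-1 : K) * H a ⁅c, ⁅d, y⁆⁆ ⁅b, z⁆
      + (1 : K) * H a ⁅d, ⁅c, y⁆⁆ ⁅b, z⁆
      + (2 : K) * H a ⁅b, ⁅c, ⁅d, y⁆⁆⁆ z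
      + (-2 : K) * H a ⁅b, ⁅d, ⁅c, y⁆⁆⁆ z
      + (-2 : K) * H a ⁅c, ⁅b, ⁅d, y⁆⁆⁆ z
      + (2 : K) * H a ⁅c, ⁅d, ⁅b, y⁆⁆⁆ z
      + (2 : K) * H a ⁅d, ⁅b, ⁅c, y⁆⁆⁆ z
      + (-2 : K) * H a ⁅d, ⁅c, ⁅b, y⁆⁆⁆ z
      + (-3 : K) * H b c ⁅a, ⁅d, ⁅y, z⁆⁆⁆
      + (2 : K) * H b c ⁅a, ⁅y, ⁅d, z⁆⁆⁆
      + (3 : K) * H b c ⁅d, ⁅a, ⁅y, z⁆⁆⁆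
      + (-2 : K) * H b c ⁅d, ⁅y, ⁅a, z⁆⁆⁆
      + (1 : K) * H b c ⁅y, ⁅a, ⁅d, z⁆⁆⁆
      + (-1 : K) * H b c ⁅y, ⁅d, ⁅a, z⁆⁆⁆
      + (-1 : K) * H b ⁅a, c⁆ ⁅d, ⁅y, z⁆⁆
      + (-1 : K) * H b ⁅a, c⁆ ⁅y, ⁅d, z⁆⁆
      + (3 : K) * H b d ⁅a, ⁅c, ⁅y, z⁆⁆⁆
      + (-2 : K) * H b d ⁅a, ⁅y, ⁅c, z⁆⁆⁆
      + (-3 : K) * H b d ⁅c, ⁅a, ⁅y, z⁆⁆⁆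
      + (2 : K) * H b d ⁅c, ⁅y, ⁅a, z⁆⁆⁆
      + (-1 : K) * H b d ⁅y, ⁅a, ⁅c, z⁆⁆⁆
      + (1 : K) * H b d ⁅y, ⁅c, ⁅a, z⁆⁆⁆
      + (1 : K) * H b ⁅a, d⁆ ⁅c, ⁅y, z⁆⁆
      + (1 : K) * H b ⁅a, d⁆ ⁅y, ⁅c, z⁆⁆
      + (-1 : K) * H b ⁅c, d⁆ ⁅a, ⁅y, z⁆⁆
      + (-1 : K) * H b ⁅c, d⁆ ⁅y, ⁅a, z⁆⁆
      + (2 : K) * H b y ⁅a, ⁅c, ⁅d, z⁆⁆⁆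
      + (-2 : K) * H b y ⁅a, ⁅d, ⁅c, z⁆⁆⁆
      + (-2 : K) * H b y ⁅c, ⁅a, ⁅d, z⁆⁆⁆
      + (2 : K) * H b y ⁅c, ⁅d, ⁅a, z⁆⁆⁆
      + (2 : K) * H b y ⁅d, ⁅a, ⁅c, z⁆⁆⁆
      + (-2 : K) * H b y ⁅d, ⁅c, ⁅a, z⁆⁆⁆
      + (-1 : K) * H b ⁅a, y⁆ ⁅c, ⁅d, z⁆⁆
      + (1 : K) * H b ⁅a, y⁆ ⁅d, ⁅c, z⁆⁆
      + (1 : K) * H b ⁅c, y⁆ ⁅a, ⁅d, z⁆⁆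
      + (-1 : K) * H b ⁅c, y⁆ ⁅d, ⁅a, z⁆⁆
      + (1 : K) * H b ⁅a, ⁅c, y⁆⁆ ⁅d, z⁆
      + (-1 : K) * H b ⁅c, ⁅a, y⁆⁆ ⁅d, z⁆
      + (-1 : K) * H b ⁅d, y⁆ ⁅a, ⁅c, z⁆⁆
      + (1 : K) * H b ⁅d, y⁆ ⁅c, ⁅a, z⁆⁆
      + (-1 : K) * H b ⁅a, ⁅d, y⁆⁆ ⁅c, z⁆
      + (1 : K) * H b ⁅d, ⁅a, y⁆⁆ ⁅c, z⁆
      + (1 : K) * H b ⁅c, ⁅d, y⁆⁆ ⁅a, z⁆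
      + (-1 : K) * H b ⁅d, ⁅c, y⁆⁆ ⁅a, z⁆
      + (-2 : K) * H b ⁅a, ⁅c, ⁅d, y⁆⁆⁆ z
      + (2 : K) * H b ⁅a, ⁅d, ⁅c, y⁆⁆⁆ z
      + (2 : K) * H b ⁅c, ⁅a, ⁅d, y⁆⁆⁆ z
      + (-2 : K) * H b ⁅c, ⁅d, ⁅a, y⁆⁆⁆ z
      + (-2 : K) * H b ⁅d, ⁅a, ⁅c, y⁆⁆⁆ z
      + (2 : K) * H b ⁅d, ⁅c, ⁅a, y⁆⁆⁆ z
      + (-1 : K) * H ⁅a, b⁆ c ⁅d, ⁅y, z⁆⁆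
      + (-1 : K) * H ⁅a, b⁆ c ⁅y, ⁅d, z⁆⁆
      + (1 : K) * H ⁅a, b⁆ d ⁅c, ⁅y, z⁆⁆
      + (1 : K) * H ⁅a, b⁆ d ⁅y, ⁅c, z⁆⁆
      + (2 : K) * H ⁅a, b⁆ y ⁅c, ⁅d, z⁆⁆
      + (-2 : K) * H ⁅a, b⁆ y ⁅d, ⁅c, z⁆⁆
      + (-1 : K) * H ⁅a, b⁆ ⁅c, y⁆ ⁅d, z⁆
      + (1 : K) * H ⁅a, b⁆ ⁅d, y⁆ ⁅c, z⁆
      + (4 : K) * H ⁅a, b⁆ ⁅c, ⁅d, y⁆⁆ z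
      + (-4 : K) * H ⁅a, b⁆ ⁅d, ⁅c, y⁆⁆ z
      + (-3 : K) * H c d ⁅a, ⁅b, ⁅y, z⁆⁆⁆
      + (2 : K) * H c d ⁅a, ⁅y, ⁅b, z⁆⁆⁆
      + (3 : K) * H c d ⁅b, ⁅a, ⁅y, z⁆⁆⁆
      + (-2 : K) * H c d ⁅b, ⁅y, ⁅a, z⁆⁆⁆
      + (1 : K) * H c d ⁅y, ⁅a, ⁅b, z⁆⁆⁆
      + (-1 : K) * H c d ⁅y, ⁅b, ⁅a, z⁆⁆⁆
      + (-1 : K) * H c ⁅a, d⁆ ⁅b, ⁅y, z⁆⁆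
      + (-1 : K) * H c ⁅a, d⁆ ⁅y, ⁅b, z⁆⁆
      + (1 : K) * H c ⁅b, d⁆ ⁅a, ⁅y, z⁆⁆
      + (1 : K) * H c ⁅b, d⁆ ⁅y, ⁅a, z⁆⁆
      + (-2 : K) * H c y ⁅a, ⁅b, ⁅d, z⁆⁆⁆
      + (2 : K) * H c y ⁅a, ⁅d, ⁅b, z⁆⁆⁆
      + (2 : K) * H c y ⁅b, ⁅a, ⁅d, z⁆⁆⁆
      + (-2 : K) * H c y ⁅b, ⁅d, ⁅a, z⁆⁆⁆
      + (-2 : K) * H c y ⁅d, ⁅a, ⁅b, z⁆⁆⁆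
      + (2 : K) * H c y ⁅d, ⁅b, ⁅a, z⁆⁆⁆
      + (1 : K) * H c ⁅a, y⁆ ⁅b, ⁅d, z⁆⁆
      + (-1 : K) * H c ⁅a, y⁆ ⁅d, ⁅b, z⁆⁆
      + (-1 : K) * H c ⁅b, y⁆ ⁅a, ⁅d, z⁆⁆
      + (1 : K) * H c ⁅b, y⁆ ⁅d, ⁅a, z⁆⁆
      + (-1 : K) * H c ⁅a, ⁅b, y⁆⁆ ⁅d, z⁆
      + (1 : K) * H c ⁅b, ⁅a, y⁆⁆ ⁅d, z⁆
      + (1 : K) * H c ⁅d, y⁆ ⁅a, ⁅b, z⁆⁆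
      + (-1 : K) * H c ⁅d, y⁆ ⁅b, ⁅a, z⁆⁆
      + (1 : K) * H c ⁅a, ⁅d, y⁆⁆ ⁅b, z⁆
      + (-1 : K) * H c ⁅d, ⁅a, y⁆⁆ ⁅b, z⁆
      + (-1 : K) * H c ⁅b, ⁅d, y⁆⁆ ⁅a, z⁆
      + (1 : K) * H c ⁅d, ⁅b, y⁆⁆ ⁅a, z⁆
      + (2 : K) * H c ⁅a, ⁅b, ⁅d, y⁆⁆⁆ z
      + (-2 : K) * H c ⁅a, ⁅d, ⁅b, y⁆⁆⁆ z
      + (-2 : K) * H c ⁅b, ⁅a, ⁅d, y⁆⁆⁆ z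
      + (2 : K) * H c ⁅b, ⁅d, ⁅a, y⁆⁆⁆ z
      + (2 : K) * H c ⁅d, ⁅a, ⁅b, y⁆⁆⁆ z
      + (-2 : K) * H c ⁅d, ⁅b, ⁅a, y⁆⁆⁆ z
      + (-1 : K) * H ⁅a, c⁆ d ⁅b, ⁅y, z⁆⁆
      + (-1 : K) * H ⁅a, c⁆ d ⁅y, ⁅b, z⁆⁆
      + (-2 : K) * H ⁅a, c⁆ y ⁅b, ⁅d, z⁆⁆
      + (2 : K) * H ⁅a, c⁆ y ⁅d, ⁅b, z⁆⁆
      + (1 : K) * H ⁅a, c⁆ ⁅b, y⁆ ⁅d, z⁆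
      + (-1 : K) * H ⁅a, c⁆ ⁅d, y⁆ ⁅b, z⁆
      + (-4 : K) * H ⁅a, c⁆ ⁅b, ⁅d, y⁆⁆ z
      + (4 : K) * H ⁅a, c⁆ ⁅d, ⁅b, y⁆⁆ z
      + (1 : K) * H ⁅b, c⁆ d ⁅a, ⁅y, z⁆⁆
      + (1 : K) * H ⁅b, c⁆ d ⁅y, ⁅a, z⁆⁆
      + (2 : K) * H ⁅b, c⁆ y ⁅a, ⁅d, z⁆⁆
      + (-2 : K) * H ⁅b, c⁆ y ⁅d, ⁅a, z⁆⁆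
      + (-1 : K) * H ⁅b, c⁆ ⁅a, y⁆ ⁅d, z⁆
      + (1 : K) * H ⁅b, c⁆ ⁅d, y⁆ ⁅a, z⁆
      + (4 : K) * H ⁅b, c⁆ ⁅a, ⁅d, y⁆⁆ z
      + (-4 : K) * H ⁅b, c⁆ ⁅d, ⁅a, y⁆⁆ z
      + (2 : K) * H d y ⁅a, ⁅b, ⁅c, z⁆⁆⁆
      + (-2 : K) * H d y ⁅a, ⁅c, ⁅b, z⁆⁆⁆
      + (-2 : K) * H d y ⁅b, ⁅a, ⁅c, z⁆⁆⁆
      + (2 : K) * H d y ⁅b, ⁅c, ⁅a, z⁆⁆⁆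
      + (2 : K) * H d y ⁅c, ⁅a, ⁅b, z⁆⁆⁆
      + (-2 : K) * H d y ⁅c, ⁅b, ⁅a, z⁆⁆⁆
      + (-1 : K) * H d ⁅a, y⁆ ⁅b, ⁅c, z⁆⁆
      + (1 : K) * H d ⁅a, y⁆ ⁅c, ⁅b, z⁆⁆
      + (1 : K) * H d ⁅b, y⁆ ⁅a, ⁅c, z⁆⁆
      + (-1 : K) * H d ⁅b, y⁆ ⁅c, ⁅a, z⁆⁆
      + (1 : K) * H d ⁅a, ⁅b, y⁆⁆ ⁅c, z⁆
      + (-1 : K) * H d ⁅b, ⁅a, y⁆⁆ ⁅c, z⁆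
      + (-1 : K) * H d ⁅c, y⁆ ⁅a, ⁅b, z⁆⁆
      + (1 : K) * H d ⁅c, y⁆ ⁅b, ⁅a, z⁆⁆
      + (-1 : K) * H d ⁅a, ⁅c, y⁆⁆ ⁅b, z⁆
      + (1 : K) * H d ⁅c, ⁅a, y⁆⁆ ⁅b, z⁆
      + (1 : K) * H d ⁅b, ⁅c, y⁆⁆ ⁅a, z⁆
      + (-1 : K) * H d ⁅c, ⁅b, y⁆⁆ ⁅a, z⁆
      + (-2 : K) * H d ⁅a, ⁅b, ⁅c, y⁆⁆⁆ z
      + (2 : K) * H d ⁅a, ⁅c, ⁅b, y⁆⁆⁆ z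
      + (2 : K) * H d ⁅b, ⁅a, ⁅c, y⁆⁆⁆ z
      + (-2 : K) * H d ⁅b, ⁅c, ⁅a, y⁆⁆⁆ z
      + (-2 : K) * H d ⁅c, ⁅a, ⁅b, y⁆⁆⁆ z
      + (2 : K) * H d ⁅c, ⁅b, ⁅a, y⁆⁆⁆ z
      + (2 : K) * H ⁅a, d⁆ y ⁅b, ⁅c, z⁆⁆
      + (-2 : K) * H ⁅a, d⁆ y ⁅c, ⁅b, z⁆⁆
      + (-1 : K) * H ⁅a, d⁆ ⁅b, y⁆ ⁅c, z⁆
      + (1 : K) * H ⁅a, d⁆ ⁅c, y⁆ ⁅b, z⁆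
      + (4 : K) * H ⁅a, d⁆ ⁅b, ⁅c, y⁆⁆ z
      + (-4 : K) * H ⁅a, d⁆ ⁅c, ⁅b, y⁆⁆ z
      + (-2 : K) * H ⁅b, d⁆ y ⁅a, ⁅c, z⁆⁆
      + (2 : K) * H ⁅b, d⁆ y ⁅c, ⁅a, z⁆⁆
      + (1 : K) * H ⁅b, d⁆ ⁅a, y⁆ ⁅c, z⁆
      + (-1 : K) * H ⁅b, d⁆ ⁅c, y⁆ ⁅a, z⁆
      + (-4 : K) * H ⁅b, d⁆ ⁅a, ⁅c, y⁆⁆ z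
      + (4 : K) * H ⁅b, d⁆ ⁅c, ⁅a, y⁆⁆ z
      + (2 : K) * H ⁅c, d⁆ y ⁅a, ⁅b, z⁆⁆
      + (-2 : K) * H ⁅c, d⁆ y ⁅b, ⁅a, z⁆⁆
      + (-1 : K) * H ⁅c, d⁆ ⁅a, y⁆ ⁅b, z⁆
      + (1 : K) * H ⁅c, d⁆ ⁅b, y⁆ ⁅a, z⁆
      + (4 : K) * H ⁅c, d⁆ ⁅a, ⁅b, y⁆⁆ z
      + (-4 : K) * H ⁅c, d⁆ ⁅b, ⁅a, y⁆⁆ z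
  simp only [lie_lie, lie_sub, map_sub, map_add, LinearMap.sub_apply, LinearMap.add_apply]
  ring

set_option maxHeartbeats 2000000 in
theorem std_eq {L : Type*} [LieRing L] (y : L) (x : Fin 4 → L) :
    ∑ σ : Equiv.Perm (Fin 4), (Equiv.Perm.sign σ : ℤ) •
        ⁅⁅⁅⁅y, x (σ 0)⁆, x (σ 1)⁆, x (σ 2)⁆, x (σ 3)⁆ = S5 (x 0) (x 1) (x 2) (x 3) y := by
  rw [sum_perm_four (fun i j k l => ⁅⁅⁅⁅y, x i⁆, x j⁆, x k⁆, x l⁆)]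
  generalize x 0 = a
  generalize x 1 = b
  generalize x 2 = c
  generalize x 3 = d
  have hw : ∀ m : L, ⁅y, m⁆ = -⁅m, y⁆ := fun m => (lie_skew y m).symm
  simp only [S5, lie_lie, lie_sub, sub_lie, lie_neg, neg_lie, hw]
  abel

section Simple

variable {K L : Type*} [Field K] [LieRing L] [LieAlgebra K L]

/-- In a simple Lie algebra a nonzero ideal (given as a bracket-closed submodule) is everything. -/
theorem simple_dichotomy [LieAlgebra.IsSimple K L] (N : Submodule K L)
    (hN : ∀ w m : L, m ∈ N → ⁅w, m⁆ ∈ N) : (∀ m ∈ N, m = 0) ∨ (∀ m, m ∈ N) := by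
  let I : LieIdeal K L := { N with lie_mem := fun {w m} h => hN w m h }
  rcases LieAlgebra.IsSimple.eq_bot_or_eq_top (R := K) I with h | h
  · left
    intro m hm
    have : m ∈ I := hm
    rw [h] at this
    simpa using this
  · right
    intro m
    have : m ∈ I := by rw [h]; trivial
    exact this

theorem simple_center [LieAlgebra.IsSimple K L] (x : L) (hx : ∀ y : L, ⁅x, y⁆ = 0) : x = 0 := by
  have : x ∈ LieAlgebra.center K L := by
    rw [LieModule.mem_maxTrivSubmodule]
    intro y
    rw [← lie_skew, hx, neg_zero]
  rw [LieAlgebra.center_eq_bot] at this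
  simpa using this

theorem not_two_engel [LieAlgebra.IsSimple K L] (h3 : (3 : K) ≠ 0)
    (h : ∀ x b : L, ⁅x, ⁅x, b⁆⁆ = 0) : False := by
  have sk : ∀ x y b : L, ⁅x, ⁅y, b⁆⁆ = -⁅y, ⁅x, b⁆⁆ := by
    intro x y b
    have := h (x + y) b
    simp only [add_lie, lie_add, h, zero_add, add_zero] at this
    exact eq_neg_of_add_eq_zero_right this
  have z : ∀ x y b : L, ⁅⁅y, b⁆, x⁆ = 0 := by
    intro x y b
    have e1 : ⁅⁅y, b⁆, x⁆ = ⁅y, ⁅b, x⁆⁆ - ⁅b, ⁅y, x⁆⁆ := lie_lie y b x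
    have e2 : ⁅y, ⁅b, x⁆⁆ = -⁅b, ⁅y, x⁆⁆ := sk y b x
    have e3 : ⁅y, ⁅b, x⁆⁆ = -⁅y, ⁅x, b⁆⁆ := by rw [← lie_skew b x, lie_neg]
    have e4 : ⁅y, ⁅x, b⁆⁆ = -⁅x, ⁅y, b⁆⁆ := sk y x b
    have e5 : ⁅⁅y, b⁆, x⁆ = -⁅x, ⁅y, b⁆⁆ := (lie_skew _ _).symm
    have e6 : (3 : K) • ⁅⁅y, b⁆, x⁆ = 0 := by
      linear_combination (norm := module) e1 + e2 + (2 : K) • e5 - (2 : K) • e4 + (2 : K) • e3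
        - (2 : K) • e2
    exact (smul_eq_zero.mp e6).resolve_left h3
  apply LieAlgebra.IsSimple.non_abelian K (L := L)
  refine ⟨fun y b => simple_center (K := K) _ fun x => z x y b⟩

theorem not_three_engel [LieAlgebra.IsSimple K L] (h2 : (2 : K) ≠ 0) (h3 : (3 : K) ≠ 0)
    (h : ∀ x b : L, ⁅x, ⁅x, ⁅x, b⁆⁆⁆ = 0) : False := by
  have two : ∀ m : L, m + m = 0 → m = 0 := by
    intro m hm
    rw [← two_smul K] at hm
    exact (smul_eq_zero.mp hm).resolve_left h2
  have three : ∀ m : L, m + m + m = 0 → m = 0 := by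
    intro m hm
    have : (3 : K) • m = 0 := by rw [← hm]; module
    exact (smul_eq_zero.mp this).resolve_left h3
  have P : ∀ x y b : L, ⁅x, ⁅x, ⁅y, b⁆⁆⁆ + ⁅x, ⁅y, ⁅x, b⁆⁆⁆ + ⁅y, ⁅x, ⁅x, b⁆⁆⁆ = 0 := by
    intro x y b
    have h1 := h (x + y) b
    have h4 := h (x - y) b
    simp only [add_lie, lie_add, sub_lie, lie_sub, h] at h1 h4
    apply two
    linear_combination (norm := module) h1 - h4
  have Q : ∀ x y z b : L, ⁅x, ⁅y, ⁅z, b⁆⁆⁆ + ⁅x, ⁅z, ⁅y, b⁆⁆⁆ + ⁅y, ⁅x, ⁅z, b⁆⁆⁆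
      + ⁅y, ⁅z, ⁅x, b⁆⁆⁆ + ⁅z, ⁅x, ⁅y, b⁆⁆⁆ + ⁅z, ⁅y, ⁅x, b⁆⁆⁆ = 0 := by
    intro x y z b
    have h1 := P (x + y) z b
    simp only [add_lie, lie_add] at h1
    linear_combination (norm := module) h1 - P x z b - P y z b
  -- `X Y X X = 0`
  have R : ∀ x y b : L, ⁅x, ⁅y, ⁅x, ⁅x, b⁆⁆⁆⁆ = 0 := by
    intro x y b
    have e1 : ⁅⁅x, ⁅x, ⁅x, y⁆⁆⁆, b⁆ = 0 := by rw [h, zero_lie]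
    have e2 : ⁅x, (⁅x, ⁅x, ⁅y, b⁆⁆⁆ + ⁅x, ⁅y, ⁅x, b⁆⁆⁆ + ⁅y, ⁅x, ⁅x, b⁆⁆⁆)⁆ = 0 := by
      rw [P, lie_zero]
    have e3 : ⁅⁅x, ⁅x, ⁅x, y⁆⁆⁆, b⁆ = ⁅x, ⁅x, ⁅x, ⁅y, b⁆⁆⁆⁆ - (3 : K) • ⁅x, ⁅x, ⁅y, ⁅x, b⁆⁆⁆⁆
        + (3 : K) • ⁅x, ⁅y, ⁅x, ⁅x, b⁆⁆⁆⁆ - ⁅y, ⁅x, ⁅x, ⁅x, b⁆⁆⁆⁆ := by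
      simp only [lie_lie, lie_sub]
      module
    rw [e1] at e3
    simp only [lie_add, h, lie_zero] at e2 e3
    apply two
    apply three
    linear_combination (norm := module) (3 : K) • e2 - e3
  have S : ∀ x y z b : L, ⁅x, ⁅y, ⁅z, ⁅x, ⁅x, b⁆⁆⁆⁆⁆ = 0 := by
    intro x y z b
    have e1 := Q x y z ⁅x, ⁅x, b⁆⁆
    have e2 := R x ⁅y, z⁆ b
    simp only [R, h, lie_zero, lie_lie, lie_sub] at e1 e2
    apply two
    linear_combination (norm := module) e1 + e2
  apply not_two_engel (K := K) (L := L) h3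
  intro x b
  let N : Submodule K L :=
    { carrier := {m | ⁅x, m⁆ = 0 ∧ (∀ y : L, ⁅x, ⁅y, m⁆⁆ = 0) ∧ ∀ y z : L, ⁅x, ⁅y, ⁅z, m⁆⁆⁆ = 0}
      zero_mem' := by simp
      add_mem' := by
        rintro m n ⟨h1, h4, h5⟩ ⟨k1, k4, k5⟩
        refine ⟨?_, ?_, ?_⟩ <;> simp [h1, h4, h5, k1, k4, k5]
      smul_mem' := by
        rintro c m ⟨h1, h4, h5⟩
        refine ⟨?_, ?_, ?_⟩ <;> simp [h1, h4, h5] }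
  have hN : ∀ w m : L, m ∈ N → ⁅w, m⁆ ∈ N := by
    rintro w m ⟨m1, m2, m3⟩
    refine ⟨m2 w, fun y => m3 y w, fun y z => ?_⟩
    have s1 : ∀ p q r : L, ⁅x, ⁅p, ⁅q, ⁅r, m⁆⁆⁆⁆ = ⁅x, ⁅p, ⁅r, ⁅q, m⁆⁆⁆⁆ := by
      intro p q r
      have := m3 p ⁅q, r⁆
      rw [lie_lie, lie_sub, lie_sub] at this
      exact sub_eq_zero.mp this
    have s2 : ∀ p q r : L, ⁅x, ⁅p, ⁅q, ⁅r, m⁆⁆⁆⁆ = ⁅x, ⁅q, ⁅p, ⁅r, m⁆⁆⁆⁆ := by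
      intro p q r
      have := m3 ⁅p, q⁆ r
      rw [lie_lie, lie_sub] at this
      exact sub_eq_zero.mp this
    have e := congrArg (fun t => ⁅x, t⁆) (Q y z w m)
    simp only [lie_add, lie_zero] at e
    apply two
    apply three
    linear_combination (norm := module) e + s1 y z w + s2 y z w + (s1 y z w + s2 y w z)
      + (s2 y z w + s1 z y w) + (s1 y z w + s2 y w z + s1 w y z)
  rcases simple_dichotomy N hN with hb | ht
  · exact hb _ ⟨h x b, fun y => R x y b, fun y z => S x y z b⟩
  · have : x = 0 := simple_center (K := K) x fun y => (ht y).1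
    simp [this]

end Simple

/-- A simple Lie algebra over a field of characteristic `≠ 2, 3` possesses a
nonzero commutative 2-cocycle if and only if it satisfies the standard identity of degree 5. -/
theorem simple_has_nonzero_cocycle_iff_standard_identity
    (K : Type*) [Field K] (h2 : (2 : K) ≠ 0) (h3 : (3 : K) ≠ 0)
    (L : Type*) [LieRing L] [LieAlgebra K L] [LieAlgebra.IsSimple K L] :
    (∃ φ : L →ₗ[K] L →ₗ[K] K,
      (∀ x y : L, φ x y = φ y x) ∧
      (∀ x y z : L, φ ⁅x, y⁆ z + φ ⁅z, x⁆ y + φ ⁅y, z⁆ x = 0) ∧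
      φ ≠ 0) ↔
    (∀ (y : L) (x : Fin 4 → L),
      ∑ σ : Equiv.Perm (Fin 4), (Equiv.Perm.sign σ : ℤ) •
        ⁅⁅⁅⁅y, x (σ 0)⁆, x (σ 1)⁆, x (σ 2)⁆, x (σ 3)⁆ = 0) := by
  have h6 : (6 : K) ≠ 0 := by
    have : (6 : K) = 2 * 3 := by norm_num
    rw [this]
    exact mul_ne_zero h2 h3
  simp only [std_eq]
  constructor
  · rintro ⟨φ, hs, hc, hne⟩ y x
    let N : Submodule K L :=
      { carrier := {m | ∀ ψ : L →ₗ[K] L →ₗ[K] K, (∀ x y : L, ψ x y = ψ y x) →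
          (∀ x y z : L, ψ ⁅x, y⁆ z - ψ y ⁅x, z⁆ + ψ x ⁅y, z⁆ = 0) → ψ m = 0}
        zero_mem' := by
          intro ψ _ _
          exact map_zero ψ
        add_mem' := by
          intro m n hm hn ψ p q
          rw [map_add, hm ψ p q, hn ψ p q, add_zero]
        smul_mem' := by
          intro c m hm ψ p q
          rw [map_smul, hm ψ p q, smul_zero] }
    have hN : ∀ w m : L, m ∈ N → ⁅w, m⁆ ∈ N := by
      intro w m hm ψ p q
      have h1 := hm ψ p q
      let A : L →ₗ[K] L := LieAlgebra.ad K L w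
      have h4 := hm (ψ ∘ₗ A + ψ.compl₂ A) ?_ ?_
      · ext z
        have h5 := LinearMap.congr_fun h4 z
        have h7 := LinearMap.congr_fun h1 ⁅w, z⁆
        simp [A] at h5 h7
        simpa [h7] using h5
      · intro x y
        simp only [A, LinearMap.add_apply, LinearMap.comp_apply, LinearMap.compl₂_apply,
          LieAlgebra.ad_apply]
        rw [p ⁅w, x⁆ y, p x ⁅w, y⁆]
        ring
      · intro x y z
        simp only [A, LinearMap.add_apply, LinearMap.comp_apply, LinearMap.compl₂_apply,
          LieAlgebra.ad_apply]
        have q1 := q ⁅w, x⁆ y z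
        have q2 := q x ⁅w, y⁆ z
        have q3 := q x y ⁅w, z⁆
        rw [leibniz_lie w x y, leibniz_lie w x z, leibniz_lie w y z]
        simp only [map_add, LinearMap.add_apply]
        linear_combination q1 + q2 + q3
    have hH : ∀ x y z : L, φ ⁅x, y⁆ z - φ y ⁅x, z⁆ + φ x ⁅y, z⁆ = 0 := by
      intro x y z
      have e := hc x y z
      rw [← lie_skew z x, map_neg, LinearMap.neg_apply, hs ⁅x, z⁆ y, hs ⁅y, z⁆ x] at e
      linear_combination e
    rcases simple_dichotomy N hN with hb | ht
    · apply hb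
      intro ψ p q
      ext z
      exact cocycle_kills_standard h6 ψ q _ _ _ _ _ _
    · exact absurd (LinearMap.ext fun m => ht m φ hs hH) hne
  · intro hS
    have hS' : ∀ a b c d y : L, S5 a b c d y = 0 := fun a b c d y => by
      simpa using hS y ![a, b, c, d]
    by_contra hno
    apply not_three_engel (K := K) (L := L) h2 h3
    intro a b
    by_contra hab
    have hF : Fc a b a a ≠ 0 := by
      rw [Fc_engel]
      intro e
      have e' : (2 : K) • ⁅a, ⁅a, ⁅a, b⁆⁆⁆ = 0 := by rw [← e, two_smul, two_nsmul]
      exact hab ((smul_eq_zero.mp e').resolve_left h2)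
    obtain ⟨ξ, hξ⟩ : ∃ ξ : Module.Dual K L, ξ (Fc a b a a) ≠ 0 := by
      by_contra hcon
      push Not at hcon
      exact hF ((Module.forall_dual_apply_eq_zero_iff K _).mp hcon)
    let B : L →ₗ[K] L →ₗ[K] L := LinearMap.mk₂ K (Fc a b)
      (by intro u u' v; simp only [Fc, add_lie, lie_add]; abel)
      (by intro c u v; simp only [Fc, smul_lie, lie_smul]; module)
      (by intro u u' v; simp only [Fc, add_lie, lie_add]; abel)
      (by intro c u v; simp only [Fc, smul_lie, lie_smul]; module)
    have hB : ∀ u v, B u v = Fc a b u v := fun _ _ => rfl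
    refine hno ⟨B.compr₂ ξ, ?_, ?_, ?_⟩
    · intro x y
      simp only [LinearMap.compr₂_apply, hB]
      rw [Fc_symm]
    · intro x y z
      simp only [LinearMap.compr₂_apply, hB]
      rw [← map_add, ← map_add, Fc_cocycle, hS', hS']
      simp
    · intro e
      apply hξ
      have := LinearMap.congr_fun₂ e a a
      simpa [hB] using this
end

section
/- Let K be an algebraically closed field of characteristic 0 and L a finite-dimensional simple Lie algebra over K. Then L possesses a nonzero commutative 2-cocycle if and only if L is isomorphic to sl(2,K). -/
namespace CommCocycle

open LieAlgebra LieAlgebra.IsKilling LieModule Module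

theorem sl2_of_span {K L : Type*} [Field K] [CharZero K] [LieRing L] [LieAlgebra K L]
    {h e f : L} (ht : IsSl2Triple h e f)
    (hs : ∀ x : L, ∃ a b c : K, x = a • e + b • f + c • ⁅e, f⁆) :
    Nonempty (L ≃ₗ⁅K⁆ LieAlgebra.SpecialLinear.sl (Fin 2) K) := by
  have hhe : ⁅h, e⁆ = (2 : K) • e := ht.lie_h_e_smul K
  have hhf : ⁅h, f⁆ = -((2 : K) • f) := ht.lie_lie_smul_f K
  have heh : ⁅e, h⁆ = -((2 : K) • e) := by rw [← lie_skew, hhe]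
  have hfh : ⁅f, h⁆ = (2 : K) • f := by rw [← lie_skew, hhf, neg_neg]
  have hef := ht.lie_e_f
  have hfe : ⁅f, e⁆ = -h := by rw [← lie_skew, hef]
  have hmem : ∀ A : Matrix (Fin 2) (Fin 2) K,
      A ∈ LieAlgebra.SpecialLinear.sl (Fin 2) K ↔ Matrix.trace A = 0 := fun A => Iff.rfl
  have htr : ∀ A : LieAlgebra.SpecialLinear.sl (Fin 2) K, A.1 1 1 = - A.1 0 0 := by
    intro A
    have : Matrix.trace A.1 = 0 := A.2
    rw [Matrix.trace_fin_two] at this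
    linear_combination this
  let g : LieAlgebra.SpecialLinear.sl (Fin 2) K →ₗ⁅K⁆ L :=
    { toFun := fun A => A.1 0 1 • e + A.1 1 0 • f + A.1 0 0 • h
      map_add' := by
        intro A B
        change (A.1 0 1 + B.1 0 1) • e + (A.1 1 0 + B.1 1 0) • f + (A.1 0 0 + B.1 0 0) • h = _
        module
      map_smul' := by
        intro r A
        change (r * A.1 0 1) • e + (r * A.1 1 0) • f + (r * A.1 0 0) • h =
          r • (A.1 0 1 • e + A.1 1 0 • f + A.1 0 0 • h)
        module
      map_lie' := by
        intro A B
        simp only [LieAlgebra.SpecialLinear.sl_bracket, Matrix.sub_apply, Matrix.mul_apply,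
          Fin.sum_univ_two, htr, lie_add, add_lie, lie_smul, smul_lie, lie_self, hhe, hhf, heh, hfh,
          hef, hfe]
        module }
  refine ⟨(LieEquiv.ofBijective g ⟨?_, ?_⟩).symm⟩
  · rw [injective_iff_map_eq_zero]
    intro A hA
    have h0 : A.1 0 1 • e + A.1 1 0 • f + A.1 0 0 • h = 0 := hA
    have h1 : ⁅h, A.1 0 1 • e + A.1 1 0 • f + A.1 0 0 • h⁆ = 0 := by rw [h0, lie_zero]
    have h2 : ⁅h, ⁅h, A.1 0 1 • e + A.1 1 0 • f + A.1 0 0 • h⁆⁆ = 0 := by rw [h1, lie_zero]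
    simp only [lie_add, lie_smul, lie_self, hhe, hhf, lie_neg, lie_zero] at h1 h2
    have ha : A.1 0 1 • e = 0 := by
      linear_combination (norm := module) (4⁻¹ : K) • h1 + (8⁻¹ : K) • h2
    have hb : A.1 1 0 • f = 0 := by
      linear_combination (norm := module) (-4⁻¹ : K) • h1 + (8⁻¹ : K) • h2
    have hc : A.1 0 0 • h = 0 := by
      rw [ha, hb] at h0
      simpa using h0
    have ha' := (smul_eq_zero.mp ha).resolve_right ht.e_ne_zero
    have hb' := (smul_eq_zero.mp hb).resolve_right ht.f_ne_zero
    have hc' := (smul_eq_zero.mp hc).resolve_right ht.h_ne_zero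
    ext i j
    fin_cases i <;> fin_cases j <;> simp [ha', hb', hc', htr]
  · intro x
    obtain ⟨a, b, c, rfl⟩ := hs x
    refine ⟨⟨!![c, a; b, -c], ?_⟩, ?_⟩
    · rw [hmem]
      simp [Matrix.trace_fin_two]
    · change a • e + b • f + c • h = _
      rw [hef]

set_option linter.unusedSectionVars false

variable {K L : Type*} [Field K] [CharZero K] [LieRing L] [LieAlgebra K L]
    [FiniteDimensional K L] [LieAlgebra.IsKilling K L]
    {H : LieSubalgebra K L} [H.IsCartanSubalgebra] [IsTriangularizable K H L]

theorem sl2_of_kill [LieAlgebra.IsSimple K L] {γ : Weight K H L} (hγ : γ.IsNonZero)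
    {h e f : L} (ht : IsSl2Triple h e f) (he : e ∈ rootSpace H γ) (hf : f ∈ rootSpace H (-γ))
    (hk : ∀ α : Weight K H L, α.IsNonZero → α ≠ γ → α ≠ -γ → ∀ x ∈ rootSpace H α, ⁅e, x⁆ = 0) :
    Nonempty (L ≃ₗ⁅K⁆ LieAlgebra.SpecialLinear.sl (Fin 2) K) := by
  have hh := IsSl2Triple.h_eq_coroot hγ ht he hf
  have hk0 : ∀ α : Weight K H L, α.IsNonZero → α ≠ γ → α ≠ -γ → ∀ x ∈ rootSpace H α,
      ⁅f, x⁆ = 0 := by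
    intro α h0 h1 h2 x hx
    have f1 : ⁅f, x⁆ ∈ rootSpace H (-γ + α) := lie_mem_genWeightSpace_of_mem_genWeightSpace hf hx
    have f2 : ⁅f, ⁅f, x⁆⁆ ∈ rootSpace H (-γ + (-γ + α)) :=
      lie_mem_genWeightSpace_of_mem_genWeightSpace hf f1
    have hP : ∀ (χ : H → K) (k : K), χ = k • (γ : H → K) + α → ∀ y ∈ rootSpace H χ, ⁅e, y⁆ = 0 := by
      intro χ k hχ y hy
      by_contra hne
      let δ : Weight K H L := ⟨χ, fun hb => hne (by
        rw [rootSpace, hb] at hy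
        have : y = 0 := by simpa using hy
        rw [this, lie_zero])⟩
      have hδ : ∀ y, δ y = k * γ y + α y := fun y => congrFun hχ y
      have hp : ∀ c : K, ¬ ((δ : H → K) = c • (γ : H → K)) := by
        intro c hc
        have : (α : H → K) = (c - k) • (γ : H → K) := by
          ext y
          have := congrFun hc y
          rw [hδ] at this
          simp only [Pi.smul_apply, smul_eq_mul] at this ⊢
          linear_combination this
        rcases eq_neg_or_eq_of_eq_smul γ α h0 _ this with h | h
        · exact h2 h
        · exact h1 h
      refine hne (hk δ ?_ ?_ ?_ y hy)
      · intro hz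
        exact hp 0 (by rw [hz, zero_smul])
      · intro hz
        exact hp 1 (by rw [hz, one_smul])
      · intro hz
        exact hp (-1) (by rw [hz, Weight.coe_neg]; simp)
    have e0 : ⁅e, x⁆ = 0 := hP α 0 (by simp) _ hx
    have e1 : ⁅e, ⁅f, x⁆⁆ = 0 := hP _ (-1) (by simp) _ f1
    have e2 : ⁅e, ⁅f, ⁅f, x⁆⁆⁆ = 0 := hP _ (-2) (by module) _ f2
    have e3 : ⁅h, x⁆ = 0 := by
      rw [← ht.lie_e_f, lie_lie, e1, e0]; simp
    have e4 : ⁅h, ⁅f, x⁆⁆ = 0 := by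
      rw [← ht.lie_e_f, lie_lie, e2, e1]; simp
    have e5 : ⁅h, ⁅f, x⁆⁆ = -((2 : K) • ⁅f, x⁆) := by
      rw [leibniz_lie, e3, ht.lie_lie_smul_f K]; simp
    rw [e4] at e5
    exact (smul_eq_zero.mp (neg_eq_zero.mp e5.symm)).resolve_left two_ne_zero
  let S := sl2SubalgebraOfRoot hγ
  have hS : ∀ x, x ∈ S ↔ ∃ a b c : K, x = a • e + b • f + c • ⁅e, f⁆ := fun x =>
    mem_sl2SubalgebraOfRoot_iff hγ ht he hf
  have hId : ∀ y x : L, x ∈ S → ⁅y, x⁆ ∈ S := by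
    intro y x hx
    have hy : y ∈ ⨆ χ : Weight K H L, genWeightSpace L χ := by
      rw [iSup_genWeightSpace_eq_top' K H L]; trivial
    induction hy using LieSubmodule.iSup_induction' with
    | zero => rw [zero_lie]; exact S.zero_mem
    | add u v _ _ h1 h2 => rw [add_lie]; exact S.add_mem h1 h2
    | mem α y hy =>
      by_cases h0 : α.IsZero
      · have hyH : y ∈ H := by
          rw [h0.eq] at hy
          have : y ∈ rootSpace H (0 : H → K) := hy
          rw [rootSpace_zero_eq K L H] at this
          exact this
        exact (sl2SubmoduleOfRoot hγ).lie_mem (x := ⟨y, hyH⟩) (m := x) hx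
      · have hsup := sl2SubmoduleOfRoot_eq_sup γ hγ
        by_cases h1 : α = γ
        · subst h1
          have : y ∈ sl2SubmoduleOfRoot hγ := by
            rw [hsup]
            exact LieSubmodule.mem_sup_left (LieSubmodule.mem_sup_left hy)
          exact S.lie_mem this hx
        by_cases h2 : α = -γ
        · subst h2
          have : y ∈ sl2SubmoduleOfRoot hγ := by
            rw [hsup]
            exact LieSubmodule.mem_sup_left (LieSubmodule.mem_sup_right hy)
          exact S.lie_mem this hx
        have k1 := hk α h0 h1 h2 y hy
        have k2 := hk0 α h0 h1 h2 y hy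
        obtain ⟨a, b, c, rfl⟩ := (hS x).mp hx
        have k3 : ⁅y, e⁆ = 0 := by rw [← lie_skew, k1, neg_zero]
        have k4 : ⁅y, f⁆ = 0 := by rw [← lie_skew, k2, neg_zero]
        have k5 : ⁅y, ⁅e, f⁆⁆ = 0 := by rw [leibniz_lie, k3, k4]; simp
        simp only [lie_add, lie_smul, k3, k4, k5, smul_zero, add_zero]
        exact S.zero_mem
  let I : LieIdeal K L := { S.toSubmodule with lie_mem := fun {y x} hx => hId y x hx }
  have hI : ∀ x, x ∈ I ↔ x ∈ S := fun x => Iff.rfl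
  have hT : I = ⊤ := by
    refine (LieAlgebra.IsSimple.eq_bot_or_eq_top I).resolve_left fun hb => ?_
    have : e ∈ I := (hI e).mpr ((hS e).mpr ⟨1, 0, 0, by simp⟩)
    rw [hb] at this
    exact ht.e_ne_zero (by simpa using this)
  refine sl2_of_span ht fun x => (hS x).mp ((hI x).mp ?_)
  rw [hT]; trivial

theorem exists_pair_ne {x : L} {χ : H → K} (hx : x ∈ rootSpace H χ) (h0 : x ≠ 0) :
    ∃ y ∈ rootSpace H (-χ), killingForm K L x y ≠ 0 := by
  by_contra! hc
  have := mem_ker_killingForm_of_mem_rootSpace_of_forall_rootSpace_neg K L H hx hc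
  rw [ker_killingForm_eq_bot] at this
  exact h0 (by simpa using this)

theorem exists_decomp [LieAlgebra.IsSimple K L]
    (hn : ¬ Nonempty (L ≃ₗ⁅K⁆ LieAlgebra.SpecialLinear.sl (Fin 2) K))
    {γ : Weight K H L} (hγ : γ.IsNonZero) :
    ∃ α β : Weight K H L, α.IsNonZero ∧ β.IsNonZero ∧ (∀ h, γ h = α h + β h) ∧
      (∃ h, γ h = 0 ∧ α h ≠ 0) ∧
      ∃ x ∈ rootSpace H α, ∃ y ∈ rootSpace H β, ⁅x, y⁆ ≠ 0 := by
  obtain ⟨h, e, f, ht, he, hf⟩ := exists_isSl2Triple_of_weight_isNonZero hγ.neg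
  have hex : ∃ α : Weight K H L, α.IsNonZero ∧ α ≠ -γ ∧ α ≠ - -γ ∧
      ∃ x ∈ rootSpace H α, ⁅e, x⁆ ≠ 0 := by
    by_contra! hc
    exact hn (sl2_of_kill hγ.neg ht he hf hc)
  obtain ⟨α, a0, a1, a2, x, hx, hex⟩ := hex
  rw [neg_neg] at a2
  have hm : ⁅e, x⁆ ∈ rootSpace H (⇑(-γ) + ⇑α) := lie_mem_genWeightSpace_of_mem_genWeightSpace he hx
  obtain ⟨y, hy, hxy⟩ := exists_pair_ne hm hex
  have hxy' : killingForm K L e ⁅x, y⁆ ≠ 0 := by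
    rwa [killingForm, traceForm_apply_lie_apply] at hxy
  have hb : ⁅x, y⁆ ≠ 0 := fun h0 => hxy' (by rw [h0, map_zero])
  let β : Weight K H L := ⟨-(⇑(-γ) + ⇑α), fun h0 => hb (by
    rw [rootSpace, h0] at hy
    have : y = 0 := by simpa using hy
    rw [this, lie_zero])⟩
  have hβ : ∀ z, β z = -(-γ z + α z) := fun z => rfl
  refine ⟨α, β, a0, ?_, ?_, ?_, x, hx, y, hy, hb⟩
  · intro hz
    apply a2
    ext z
    have := congrFun hz z
    rw [hβ] at this
    simp only [Pi.zero_apply] at this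
    linear_combination -this
  · intro z
    rw [hβ]; ring
  · by_contra! hc
    obtain ⟨z, hz⟩ : ∃ z, γ z ≠ 0 := by
      by_contra! hc'
      exact hγ (funext hc')
    have : (α : H → K) = (α z / γ z) • (γ : H → K) := by
      ext w
      have h1 := hc (γ z • w - γ w • z)
      have h2 : γ (γ z • w - γ w • z) = 0 := by
        change Weight.toLinear K H L γ (γ z • w - γ w • z) = 0
        rw [map_sub, map_smul, map_smul]
        simp only [Weight.toLinear_apply, smul_eq_mul]; ring
      have h3 := h1 h2
      change Weight.toLinear K H L α (γ z • w - γ w • z) = 0 at h3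
      rw [map_sub, map_smul, map_smul] at h3
      simp only [Weight.toLinear_apply, smul_eq_mul] at h3
      simp only [Pi.smul_apply, smul_eq_mul]
      field_simp
      linear_combination h3
    rcases eq_neg_or_eq_of_eq_smul γ α a0 _ this with h | h
    · exact a1 h
    · exact a2 h

theorem cocycle_zero [LieAlgebra.IsSimple K L]
    (hn : ¬ Nonempty (L ≃ₗ⁅K⁆ LieAlgebra.SpecialLinear.sl (Fin 2) K))
    (H : LieSubalgebra K L) [H.IsCartanSubalgebra] [IsTriangularizable K H L]
    (φ : L →ₗ[K] L →ₗ[K] K) (hs : ∀ x y : L, φ x y = φ y x)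
    (hc : ∀ x y z : L, φ ⁅x, y⁆ z + φ ⁅z, x⁆ y + φ ⁅y, z⁆ x = 0) : φ = 0 := by
  have hlie : ∀ {χ : H → K} {x : L}, x ∈ rootSpace H χ → ∀ h : H, ⁅(h : L), x⁆ = χ h • x :=
    fun hx h => lie_eq_smul_of_mem_rootSpace hx h
  have hadd : ∀ {χ₁ χ₂ : H → K} {x y : L}, x ∈ rootSpace H χ₁ → y ∈ rootSpace H χ₂ →
      ⁅x, y⁆ ∈ rootSpace H (χ₁ + χ₂) := fun hx hy =>
    lie_mem_genWeightSpace_of_mem_genWeightSpace hx hy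
  have hzero : ∀ {x : L}, x ∈ rootSpace H (0 : H → K) → x ∈ H := by
    intro x hx
    rw [rootSpace_zero_eq K L H] at hx
    exact hx
  have hzero' : ∀ x : H, (x : L) ∈ rootSpace H (0 : H → K) := by
    intro x
    rw [rootSpace_zero_eq K L H]
    exact x.2
  -- the basic identity
  have F : ∀ {χ₁ χ₂ : H → K} {x y : L}, x ∈ rootSpace H χ₁ → y ∈ rootSpace H χ₂ → ∀ h : H,
      (χ₁ h - χ₂ h) * φ x y = - φ ⁅x, y⁆ h := by
    intro χ₁ χ₂ x y hx hy h
    have := hc h x y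
    rw [← lie_skew y (h : L), hlie hx, hlie hy, hs ⁅x, y⁆ (h : L)] at this
    simp only [map_smul, map_neg, LinearMap.smul_apply, LinearMap.neg_apply, smul_eq_mul] at this
    rw [hs ⁅x, y⁆ (h : L), hs y x] at *
    linear_combination this
  -- `H` is orthogonal to the root spaces
  have A : ∀ γ : Weight K H L, γ.IsNonZero → ∀ z ∈ rootSpace H γ, ∀ h : H, φ z h = 0 := by
    intro γ hγ z hz h
    obtain ⟨α, β, a0, b0, hγαβ, ⟨k, hk0, hk1⟩, x, hx, y, hy, hxy⟩ := exists_decomp hn hγ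
    have hxyγ : ⁅x, y⁆ ∈ rootSpace H γ := by
      have := hadd hx hy
      rwa [show (α : H → K) + β = γ from funext fun h => (hγαβ h).symm] at this
    obtain ⟨c, hc'⟩ : ∃ c : K, c • ⁅x, y⁆ = z := by
      have := finrank_rootSpace_eq_one γ hγ
      obtain ⟨c, hc'⟩ := (finrank_eq_one_iff_of_nonzero' (⟨⁅x, y⁆, hxyγ⟩ : rootSpace H γ)
        (by simpa [Subtype.ext_iff] using hxy)).mp this ⟨z, hz⟩
      exact ⟨c, congrArg Subtype.val hc'⟩
    have E1 : ∀ h h' : H, γ h * φ h' ⁅x, y⁆ = γ h' * φ h ⁅x, y⁆ := by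
      intro h h'
      have := F (hzero' h') hxyγ h
      rw [hlie hxyγ] at this
      simp only [map_smul, LinearMap.smul_apply, smul_eq_mul, Pi.zero_apply] at this
      rw [hs ⁅x, y⁆ h] at this
      linear_combination -this
    obtain ⟨u, hu⟩ : ∃ z, γ z ≠ 0 := by
      by_contra! hc'
      exact hγ (funext hc')
    have E2 : φ k ⁅x, y⁆ = 0 := by
      have := E1 k u
      rw [hk0, zero_mul] at this
      exact (mul_eq_zero.mp this.symm).resolve_left hu
    have E3 : φ x y = 0 := by
      have := F hx hy k
      rw [hs ⁅x, y⁆, E2, neg_zero] at this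
      refine (mul_eq_zero.mp this).resolve_left ?_
      have h1 := hγαβ k
      rw [hk0] at h1
      intro h2
      apply hk1
      have : 2 * α k = 0 := by linear_combination h2 - h1
      exact (mul_eq_zero.mp this).resolve_left two_ne_zero
    have E4 : φ ⁅x, y⁆ h = 0 := by
      have := F hx hy h
      rw [E3, mul_zero] at this
      exact neg_eq_zero.mp this.symm
    rw [← hc', map_smul, LinearMap.smul_apply, E4, smul_zero]
  -- opposite root spaces: scalars
  have S : ∀ α : Weight K H L, α.IsNonZero → ∃ s : K,
      (∀ h : H, φ ((cartanEquivDual H).symm α : H) h = - (2 * s * α h)) ∧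
      ∀ x ∈ rootSpace H α, ∀ y ∈ rootSpace H (-α), φ x y = s * killingForm K L x y := by
    intro α hα
    have G : ∀ x ∈ rootSpace H α, ∀ y ∈ rootSpace H (-α), ∀ h : H,
        2 * α h * φ x y = - (killingForm K L x y * φ ((cartanEquivDual H).symm α : H) h) := by
      intro x hx y hy h
      have := F hx hy h
      rw [lie_eq_killingForm_smul_of_mem_rootSpace_of_mem_rootSpace_neg hx hy] at this
      simp only [map_smul, LinearMap.smul_apply, smul_eq_mul, Pi.neg_apply] at this
      linear_combination this
    obtain ⟨e, he, he0⟩ := α.exists_ne_zero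
    obtain ⟨f, hf, hef⟩ := exists_pair_ne he he0
    obtain ⟨u, hu⟩ : ∃ z, α z ≠ 0 := by
      by_contra! hc'
      exact hα (funext hc')
    refine ⟨φ e f / killingForm K L e f, ?_, ?_⟩
    · intro h
      have := G e he f hf h
      field_simp
      linear_combination this
    · intro x hx y hy
      have h1 := G e he f hf u
      have h2 := G x hx y hy u
      field_simp
      have : 2 * α u * (φ x y * killingForm K L e f - killingForm K L x y * φ e f) = 0 := by
        linear_combination killingForm K L e f * h2 - killingForm K L x y * h1
      have := (mul_eq_zero.mp this).resolve_left (mul_ne_zero two_ne_zero hu)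
      linear_combination this
  have S0 : ∀ γ : Weight K H L, γ.IsNonZero →
      (∀ h : H, φ ((cartanEquivDual H).symm γ : H) h = 0) ∧
      ∀ x ∈ rootSpace H γ, ∀ y ∈ rootSpace H (-γ), φ x y = 0 := by
    intro γ hγ
    obtain ⟨α, β, a0, b0, hγαβ, ⟨k, hk0, hk1⟩, x, hx, y, hy, hxy⟩ := exists_decomp hn hγ
    obtain ⟨s, s1, s2⟩ := S γ hγ
    obtain ⟨p, p1, p2⟩ := S α a0
    obtain ⟨q, q1, q2⟩ := S β b0
    have hγf : (α : H → K) + β = γ := funext fun h => (hγαβ h).symm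
    have ht : ((cartanEquivDual H).symm γ : H) =
        (cartanEquivDual H).symm α + (cartanEquivDual H).symm β := by
      rw [← map_add]
      congr 1
      ext h
      exact hγαβ h
    have E : ∀ h : H, s * γ h = p * α h + q * β h := by
      intro h
      have h1 := s1 h
      rw [ht] at h1
      have h2 : φ (((cartanEquivDual H).symm α + (cartanEquivDual H).symm β : H) : L) h =
        φ ((cartanEquivDual H).symm α : H) h + φ ((cartanEquivDual H).symm β : H) h := by
        exact DFunLike.congr_fun (map_add φ _ _) _
      rw [h2, p1, q1] at h1
      have : (2 : K) * (s * γ h - (p * α h + q * β h)) = 0 := by linear_combination h1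
      linear_combination (mul_eq_zero.mp this).resolve_left two_ne_zero
    have hpq : p = q := by
      have h1 := E k
      have h2 := hγαβ k
      rw [hk0] at h1 h2
      have : (p - q) * α k = 0 := by linear_combination -h1 + q * h2
      exact sub_eq_zero.mp ((mul_eq_zero.mp this).resolve_right hk1)
    obtain ⟨u, hu⟩ : ∃ z, γ z ≠ 0 := by
      by_contra! hc'
      exact hγ (funext hc')
    have hsp : s = p := by
      have h1 := E u
      rw [← hpq] at h1
      have : (s - p) * γ u = 0 := by linear_combination h1 - p * hγαβ u
      exact sub_eq_zero.mp ((mul_eq_zero.mp this).resolve_right hu)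
    have hxyγ : ⁅x, y⁆ ∈ rootSpace H γ := by
      have := hadd hx hy
      rwa [hγf] at this
    obtain ⟨z, hz, hxyz⟩ := exists_pair_ne hxyγ hxy
    have z1 : ⁅z, x⁆ ∈ rootSpace H (-β) := by
      have := hadd hz hx
      rwa [show -(γ : H → K) + α = -β by rw [← hγf]; abel] at this
    have z2 : ⁅y, z⁆ ∈ rootSpace H (-α) := by
      have := hadd hy hz
      rwa [show (β : H → K) + -γ = -α by rw [← hγf]; abel] at this
    have c1 := s2 _ hxyγ _ hz
    have c2 := q2 _ hy _ z1
    have c3 := p2 _ hx _ z2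
    have k1 : killingForm K L y ⁅z, x⁆ = killingForm K L ⁅x, y⁆ z := by
      rw [killingForm, traceForm_comm, traceForm_apply_lie_apply, traceForm_comm]
    have k2 : killingForm K L x ⁅y, z⁆ = killingForm K L ⁅x, y⁆ z := by
      rw [killingForm, traceForm_apply_lie_apply]
    have c4 := hc x y z
    rw [hs ⁅z, x⁆, hs ⁅y, z⁆, c1, c2, c3, k1, k2, ← hpq, ← hsp] at c4
    have hs0 : s = 0 := by
      have : (3 * killingForm K L ⁅x, y⁆ z) * s = 0 := by linear_combination c4
      exact (mul_eq_zero.mp this).resolve_left (mul_ne_zero three_ne_zero hxyz)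
    subst hs0
    refine ⟨fun h => by rw [s1]; ring, fun x hx y hy => by rw [s2 x hx y hy]; ring⟩
  -- `H` is self-orthogonal
  have HH : ∀ h h' : H, φ h h' = 0 := by
    intro h h'
    let ψ : H →ₗ[K] K := (φ.flip (h' : L)).comp H.toSubmodule.subtype
    let T : Submodule K (Dual K H) := (LinearMap.ker ψ).comap (cartanEquivDual H).symm.toLinearMap
    have hT : T = ⊤ := by
      rw [eq_top_iff, ← span_weight_isNonZero_eq_top K L H, Submodule.span_le]
      rintro _ ⟨α, hα, rfl⟩
      exact (S0 α hα).1 h'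
    have : cartanEquivDual H h ∈ T := by rw [hT]; trivial
    have : ψ ((cartanEquivDual H).symm (cartanEquivDual H h)) = 0 := this
    rw [LinearEquiv.symm_apply_apply] at this
    exact this
  -- weight spaces of different weight
  have D : ∀ {χ₁ χ₂ : H → K} {x y : L}, χ₁ ≠ χ₂ → x ∈ rootSpace H χ₁ → y ∈ rootSpace H χ₂ →
      φ x y = 0 := by
    intro χ₁ χ₂ x y hne hx hy
    obtain ⟨u, hu⟩ : ∃ u, χ₁ u ≠ χ₂ u := by
      by_contra! hc'
      exact hne (funext hc')
    have hF := F hx hy u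
    have : φ ⁅x, y⁆ u = 0 := by
      by_cases h0 : ⁅x, y⁆ = 0
      · rw [h0]; simp
      have hm := hadd hx hy
      by_cases hz : χ₁ + χ₂ = 0
      · rw [hz] at hm
        exact HH ⟨_, hzero hm⟩ u
      · let δ : Weight K H L := ⟨χ₁ + χ₂, fun hb => h0 (by
          rw [rootSpace, hb] at hm; simpa using hm)⟩
        exact A δ hz _ hm u
    rw [this, neg_zero] at hF
    exact (mul_eq_zero.mp hF).resolve_left (sub_ne_zero.mpr hu)
  -- equal weights
  have Q : ∀ γ : Weight K H L, ∀ x ∈ rootSpace H γ, ∀ y ∈ rootSpace H γ, φ x y = 0 := by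
    intro γ w hw z hz
    by_cases hγ : γ.IsZero
    · rw [hγ.eq] at hw hz
      exact HH ⟨w, hzero hw⟩ ⟨z, hzero hz⟩
    obtain ⟨α, β, a0, b0, hγαβ, ⟨k, hk0, hk1⟩, x, hx, y, hy, hxy⟩ := exists_decomp hn hγ
    have hγf : (α : H → K) + β = γ := funext fun h => (hγαβ h).symm
    have hxyγ : ⁅x, y⁆ ∈ rootSpace H γ := by
      have := hadd hx hy
      rwa [hγf] at this
    obtain ⟨c, hc'⟩ : ∃ c : K, c • ⁅x, y⁆ = w := by
      have := finrank_rootSpace_eq_one γ hγ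
      obtain ⟨c, hc'⟩ := (finrank_eq_one_iff_of_nonzero' (⟨⁅x, y⁆, hxyγ⟩ : rootSpace H γ)
        (by simpa [Subtype.ext_iff] using hxy)).mp this ⟨w, hw⟩
      exact ⟨c, congrArg Subtype.val hc'⟩
    have hβk : β k = - α k := by
      have := hγαβ k
      rw [hk0] at this
      linear_combination -this
    have h2 : 2 * α k ≠ 0 := mul_ne_zero two_ne_zero hk1
    have e1 : φ ⁅z, x⁆ y = 0 := by
      refine D ?_ (hadd hz hx) hy
      intro h
      have := congrFun h k
      simp only [Pi.add_apply, hk0, hβk] at this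
      exact h2 (by linear_combination this)
    have e2 : φ ⁅y, z⁆ x = 0 := by
      refine D ?_ (hadd hy hz) hx
      intro h
      have := congrFun h k
      simp only [Pi.add_apply, hk0, hβk] at this
      exact h2 (by linear_combination -this)
    have := hc x y z
    rw [e1, e2, add_zero, add_zero] at this
    rw [← hc', map_smul, LinearMap.smul_apply, this, smul_zero]
  have htop : ∀ y : L, y ∈ ⨆ χ : Weight K H L, genWeightSpace L χ := by
    intro y
    rw [iSup_genWeightSpace_eq_top' K H L]; trivial
  ext x y
  rw [LinearMap.zero_apply, LinearMap.zero_apply]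
  refine LieSubmodule.iSup_induction _ (motive := fun x => φ x y = 0) (htop x) ?_ (by simp) ?_
  · intro α x hx
    refine LieSubmodule.iSup_induction _ (motive := fun y => φ x y = 0) (htop y) ?_ (by simp) ?_
    · intro β y hy
      by_cases h : α = β
      · subst h
        exact Q α x hx y hy
      · exact D (fun h' => h (DFunLike.coe_injective h')) hx hy
    · intro u v hu hv
      rw [map_add, hu, hv, add_zero]
  · intro u v hu hv
    rw [map_add, LinearMap.add_apply, hu, hv, add_zero]

end CommCocycle


/-- A finite-dimensional simple Lie algebra over an algebraically closed field
of characteristic 0 possesses a nonzero commutative 2-cocycle if and only if it is isomorphic to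
`sl(2,K)`. -/
theorem simple_has_nonzero_cocycle_iff_sl2
    (K : Type*) [Field K] [IsAlgClosed K] [CharZero K]
    (L : Type*) [LieRing L] [LieAlgebra K L]
    [FiniteDimensional K L] [LieAlgebra.IsSimple K L] :
    (∃ φ : L →ₗ[K] L →ₗ[K] K,
      (∀ x y : L, φ x y = φ y x) ∧
      (∀ x y z : L, φ ⁅x, y⁆ z + φ ⁅z, x⁆ y + φ ⁅y, z⁆ x = 0) ∧
      φ ≠ 0) ↔
    Nonempty (L ≃ₗ⁅K⁆ LieAlgebra.SpecialLinear.sl (Fin 2) K) := by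
  constructor
  · rintro ⟨φ, hs, hc, h0⟩
    by_contra hn
    obtain ⟨x, hx⟩ := LieAlgebra.exists_isCartanSubalgebra_engel K L
    exact h0 (CommCocycle.cocycle_zero hn (LieSubalgebra.engel K x) φ hs hc)
  · rintro ⟨g⟩
    let p : L →ₗ[K] K :=
      { toFun := fun x => (g x).1 0 1
        map_add' := fun x y => by rw [map_add]; rfl
        map_smul' := fun r x => by rw [map_smul]; rfl }
    have hp : ∀ x, p x = (g x).1 0 1 := fun x => rfl
    have htr : ∀ A : LieAlgebra.SpecialLinear.sl (Fin 2) K, A.1 1 1 = - A.1 0 0 := by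
      intro A
      have : Matrix.trace A.1 = 0 := A.2
      rw [Matrix.trace_fin_two] at this
      linear_combination this
    refine ⟨LinearMap.mul K K |>.compl₁₂ p p, ?_, ?_, ?_⟩
    · intro x y
      simp [mul_comm]
    · intro x y z
      simp only [LinearMap.compl₁₂_apply, LinearMap.mul_apply', hp, LieEquiv.map_lie,
        LieAlgebra.SpecialLinear.sl_bracket, Matrix.sub_apply, Matrix.mul_apply,
        Fin.sum_univ_two, htr]
      ring
    · intro h
      let e : LieAlgebra.SpecialLinear.sl (Fin 2) K :=
        LieAlgebra.SpecialLinear.single 0 1 (by decide) 1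
      have h1 := LinearMap.congr_fun₂ h (g.symm e) (g.symm e)
      have h2 : p (g.symm e) = 1 := by
        rw [hp, LieEquiv.apply_symm_apply]
        simp [e]
      simp [h2] at h1
end

section
/- Let K be a field of characteristic p > 3, let G be a finite additive subgroup of K, and let L be the Lie algebra over K with basis (e_α)_{α ∈ G} and multiplication [e_α, e_β] = (β − α) e_{α+β} for α, β ∈ G. Then a symmetric bilinear form φ: L × L → K is a commutative 2-cocycle on L if and only if φ(e_α, e_β) = φ(e_0, e_{α+β}) for all α, β ∈ G. -/
/-- Let `K` be a field of characteristic `p > 3`, `G` a finite additive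
subgroup of `K`, and `L` the Lie algebra over `K` with basis `(e_α)_{α ∈ G}` and bracket
`[e_α, e_β] = (β − α) e_{α+β}` (the Zassenhaus algebra). Then a symmetric bilinear form `φ`
on `L` is a commutative 2-cocycle if and only if `φ(e_α, e_β) = φ(e_0, e_{α+β})` for all
`α, β ∈ G`. -/
theorem zassenhaus_cocycle_characterization
    (K : Type*) [Field K] (p : ℕ) [Fact p.Prime] [CharP K p] (hp : 3 < p)
    (G : AddSubgroup K) [Finite G]
    (L : Type*) [LieRing L] [LieAlgebra K L]
    (e : Module.Basis G K L)
    (he : ∀ α β : G, ⁅e α, e β⁆ = ((β : K) - (α : K)) • e (α + β))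
    (φ : L →ₗ[K] L →ₗ[K] K)
    (hsymm : ∀ x y : L, φ x y = φ y x) :
    (∀ x y z : L, φ ⁅x, y⁆ z + φ ⁅z, x⁆ y + φ ⁅y, z⁆ x = 0) ↔
    (∀ α β : G, φ (e α) (e β) = φ (e 0) (e (α + β))) := by
  constructor
  · intro h
    have key : ∀ α β γ : G, ((β : K) - α) * φ (e (α + β)) (e γ)
        + ((α : K) - γ) * φ (e (γ + α)) (e β) + ((γ : K) - β) * φ (e (β + γ)) (e α) = 0 := by
      intro α β γ
      have := h (e α) (e β) (e γ)
      simpa [he] using this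
    have hne : ∀ α β : G, α ≠ β → φ (e α) (e β) = φ (e 0) (e (α + β)) := by
      intro α β hab
      have h1 := key α β 0
      rw [add_zero, zero_add, hsymm (e β) (e α), hsymm (e (α + β)) (e 0)] at h1
      have h2 : ((β : K) - α) ≠ 0 := fun h0 => hab (Subtype.ext (sub_eq_zero.mp h0).symm)
      apply mul_left_cancel₀ h2
      simp only [ZeroMemClass.coe_zero] at h1
      linear_combination -h1
    intro α β
    by_cases hab : α = β
    · subst hab
      by_cases h0 : α = 0
      · subst h0; simp
      have hα : (α : K) ≠ 0 := fun h => h0 (Subtype.ext h)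
      have h2 : (2 : K) ≠ 0 := by
        intro h
        have := (CharP.cast_eq_zero_iff K p 2).mp (by exact_mod_cast h)
        have := Nat.le_of_dvd (by norm_num) this
        omega
      have h3 : (3 : K) ≠ 0 := by
        intro h
        have := (CharP.cast_eq_zero_iff K p 3).mp (by exact_mod_cast h)
        have := Nat.le_of_dvd (by norm_num) this
        omega
      have h1 := key α (-α) (α + α)
      have h4 : α + α + α ≠ -α := by
        intro h
        have h' := congrArg (Subtype.val) h
        simp only [AddSubgroup.coe_add, AddSubgroup.coe_neg] at h'
        have : (2 : K) * (2 * α) = 0 := by linear_combination h'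
        simp [h2, hα] at this
      have h5 := hne _ _ h4
      rw [h5, show α + α + α + -α = α + α by abel, show α + -α = 0 by abel,
        show -α + (α + α) = α by abel] at h1
      simp only [AddSubgroup.coe_add, AddSubgroup.coe_neg] at h1
      apply mul_left_cancel₀ (mul_ne_zero h3 hα)
      linear_combination h1
    · exact hne α β hab
  · intro h x y z
    have hx := e.mem_span x
    have hy := e.mem_span y
    have hz := e.mem_span z
    induction hx using Submodule.span_induction with
    | zero => simp
    | add a b _ _ ha hb =>
      simp only [add_lie, lie_add, map_add, LinearMap.add_apply]
      linear_combination ha + hb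
    | smul c a _ ha =>
      simp only [smul_lie, lie_smul, map_smul, LinearMap.smul_apply, smul_eq_mul]
      linear_combination c * ha
    | mem x hx =>
      obtain ⟨α, rfl⟩ := hx
      induction hy using Submodule.span_induction with
      | zero => simp
      | add a b _ _ ha hb =>
        simp only [add_lie, lie_add, map_add, LinearMap.add_apply]
        linear_combination ha + hb
      | smul c a _ ha =>
        simp only [smul_lie, lie_smul, map_smul, LinearMap.smul_apply, smul_eq_mul]
        linear_combination c * ha
      | mem y hy =>
        obtain ⟨β, rfl⟩ := hy
        induction hz using Submodule.span_induction with
        | zero => simp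
        | add a b _ _ ha hb =>
          simp only [add_lie, lie_add, map_add, LinearMap.add_apply]
          linear_combination ha + hb
        | smul c a _ ha =>
          simp only [smul_lie, lie_smul, map_smul, LinearMap.smul_apply, smul_eq_mul]
          linear_combination c * ha
        | mem z hz =>
          obtain ⟨γ, rfl⟩ := hz
          simp only [he, map_smul, LinearMap.smul_apply, smul_eq_mul]
          rw [h (α + β) γ, h (γ + α) β, h (β + γ) α,
            show γ + α + β = α + β + γ by abel, show β + γ + α = α + β + γ by abel]
          ring
end

section
/- Let A be an associative commutative unital algebra over a field K of characteristic different from 2 and 3, and let α: A × A → K be a symmetric bilinear form satisfying α(ab,c) + α(ca,b) + α(bc,a) = 0 for all a,b,c ∈ A. Then α = 0. -/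
/-- Let `A` be an associative commutative unital algebra over a field `K` of
characteristic `≠ 2, 3` and `α` a symmetric bilinear form on `A` satisfying
`α(ab,c) + α(ca,b) + α(bc,a) = 0` for all `a,b,c`. Then `α = 0`. -/
theorem symmetric_cyclic_cocycle_vanishes
    (K : Type*) [Field K] (h2 : (2 : K) ≠ 0) (h3 : (3 : K) ≠ 0)
    (A : Type*) [CommRing A] [Algebra K A]
    (α : A →ₗ[K] A →ₗ[K] K)
    (hsymm : ∀ a b : A, α a b = α b a)
    (h : ∀ a b c : A, α (a * b) c + α (c * a) b + α (b * c) a = 0) :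
    α = 0 := by
  have h1 : ∀ a : A, α a 1 = 0 := by
    intro a
    have e := h a 1 1
    simp only [mul_one, one_mul] at e
    rw [hsymm 1 a] at e
    have e' : 3 * α a 1 = 0 := by linear_combination e
    exact (mul_eq_zero.mp e').resolve_left h3
  ext a b
  have e := h a b 1
  simp only [mul_one, one_mul] at e
  rw [h1, hsymm b a] at e
  have e' : 2 * α a b = 0 := by linear_combination e
  simpa using (mul_eq_zero.mp e').resolve_left h2
end
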